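/- arXiv:1106.5217 — 11 statements merged into one kernel-verified Lean document; each statement's English description precedes it below -/
import Mathlib

section
/- (Superadditivity inequality (4.5), eq:Bogomolov) Let s ≥ 1 and for i = 1,…,s let r_i, a_i ∈ ℝ, d_i > 0, D_i ∈ H^⊥, and set v_i := r_i·e^β + a_i·ϱ + ι_β(d_i H + D_i) ∈ M. Suppose there exist real numbers t > 0 and λ such that r_i·t − a_i = λ·d_i for every i (this expresses that all v_i have the same phase with respect to Z_{(β,ω)} with (ω,ω) = 2t). Set v := Σ_i v_i, d := Σ_i d_i, D := Σ_i D_i. Then Σ_i ⟨v_i,v_i⟩/d_i ≤ ⟨v,v⟩/d and Σ_i (⟨v_i,v_i⟩ − (D_i,D_i))/d_i ≤ (⟨v,v⟩ − (D,D))/d. -/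
noncomputable section

/-- The Mukai pairing on the real Mukai lattice `ℝ × V × ℝ`. -/
def muk {V : Type*} [AddCommGroup V] [Module ℝ V]
    (B : V →ₗ[ℝ] V →ₗ[ℝ] ℝ) (x y : ℝ × V × ℝ) : ℝ :=
  B x.2.1 y.2.1 - x.1 * y.2.2 - x.2.2 * y.1

/-- `e^γ := (1, γ, (γ,γ)/2)`. -/
def expv {V : Type*} [AddCommGroup V] [Module ℝ V]
    (B : V →ₗ[ℝ] V →ₗ[ℝ] ℝ) (γ : V) : ℝ × V × ℝ :=
  (1, γ, B γ γ / 2)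

/-- `ϱ := (0,0,1)`. -/
def rhoV (V : Type*) [AddCommGroup V] [Module ℝ V] : ℝ × V × ℝ := (0, 0, 1)

/-- `ι_β(ξ) := (0, ξ, (ξ,β))`. -/
def iota {V : Type*} [AddCommGroup V] [Module ℝ V]
    (B : V →ₗ[ℝ] V →ₗ[ℝ] ℝ) (β ξ : V) : ℝ × V × ℝ :=
  (0, ξ, B ξ β)

/-- The self-pairing of `r e^β + a ϱ + ι_β(ξ)` is `(ξ,ξ) - 2ra`. -/
theorem muk_self_coord {V : Type*} [AddCommGroup V] [Module ℝ V]
    (B : V →ₗ[ℝ] V →ₗ[ℝ] ℝ) (hB : ∀ x y, B x y = B y x) (β ξ : V) (r a : ℝ) :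
    muk B (r • expv B β + a • rhoV V + iota B β ξ)
      (r • expv B β + a • rhoV V + iota B β ξ) = B ξ ξ - 2 * r * a := by
  simp [muk, expv, rhoV, iota, hB β ξ]
  ring

theorem sum_coord {V : Type*} [AddCommGroup V] [Module ℝ V]
    (B : V →ₗ[ℝ] V →ₗ[ℝ] ℝ) (β : V) {ι : Type*} (S : Finset ι)
    (r a : ι → ℝ) (ξ : ι → V) :
    ∑ i ∈ S, (r i • expv B β + a i • rhoV V + iota B β (ξ i)) =
      (∑ i ∈ S, r i) • expv B β + (∑ i ∈ S, a i) • rhoV V + iota B β (∑ i ∈ S, ξ i) := by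
  have h : ∑ i ∈ S, iota B β (ξ i) = iota B β (∑ i ∈ S, ξ i) := by
    simp [iota, Prod.ext_iff, Prod.fst_sum, Prod.snd_sum]
  rw [Finset.sum_add_distrib, Finset.sum_add_distrib, ← Finset.sum_smul, ← Finset.sum_smul, h]

/-- Jensen's inequality for `x ↦ (x,x)/d` when the form is negative semidefinite on a subspace. -/
theorem sum_form_div_le {V : Type*} [AddCommGroup V] [Module ℝ V]
    (B : V →ₗ[ℝ] V →ₗ[ℝ] ℝ) (hB : ∀ x y, B x y = B y x) (W : Submodule ℝ V)
    (hW : ∀ x ∈ W, B x x ≤ 0) {ι : Type*} (S : Finset ι) (d : ι → ℝ) (x : ι → V)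
    (hd : ∀ i ∈ S, 0 < d i) (hx : ∀ i ∈ S, x i ∈ W) :
    ∑ i ∈ S, B (x i) (x i) / d i ≤ B (∑ i ∈ S, x i) (∑ i ∈ S, x i) / ∑ i ∈ S, d i := by
  rcases S.eq_empty_or_nonempty with rfl | hne
  · simp
  have hpos : 0 < ∑ i ∈ S, d i := Finset.sum_pos hd hne
  set X := ∑ i ∈ S, x i with hX
  set m := (∑ i ∈ S, d i)⁻¹ • X with hm
  have hmW : m ∈ W := W.smul_mem _ (W.sum_mem hx)
  have key : ∀ i ∈ S, B (x i) (x i) / d i ≤ 2 * B (x i) m - d i * B m m := by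
    intro i hi
    have h := hW _ (W.sub_mem (hx i hi) (W.smul_mem (d i) hmW))
    simp only [map_sub, map_smul, LinearMap.sub_apply, LinearMap.smul_apply, smul_eq_mul,
      hB m (x i)] at h
    rw [div_le_iff₀ (hd i hi)]
    linarith
  have hsum : ∑ i ∈ S, B (x i) m = B X m := by
    simp [hX, LinearMap.sum_apply]
  calc ∑ i ∈ S, B (x i) (x i) / d i
      ≤ ∑ i ∈ S, (2 * B (x i) m - d i * B m m) := Finset.sum_le_sum key
    _ = 2 * B X m - (∑ i ∈ S, d i) * B m m := by
        rw [Finset.sum_sub_distrib, ← Finset.mul_sum, ← Finset.sum_mul, hsum]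
    _ = B X X / ∑ i ∈ S, d i := by
        simp only [hm, map_smul, LinearMap.smul_apply, smul_eq_mul]
        field_simp
        ring

/-- Superadditivity inequality (4.5) (eq:Bogomolov). -/
theorem stmt2 {V : Type*} [AddCommGroup V] [Module ℝ V] [FiniteDimensional ℝ V]
    (B : V →ₗ[ℝ] V →ₗ[ℝ] ℝ) (hB : ∀ x y, B x y = B y x)
    (H β : V) (hH : 0 < B H H)
    (hsemi : ∀ x : V, B x H = 0 → B x x ≤ 0)
    (s : ℕ) (hs : 1 ≤ s)
    (r a d : Fin s → ℝ) (D : Fin s → V)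
    (hd : ∀ i, 0 < d i) (hD : ∀ i, B (D i) H = 0)
    (t lam : ℝ) (ht : 0 < t)
    (hphase : ∀ i, r i * t - a i = lam * d i)
    (v : Fin s → ℝ × V × ℝ)
    (hv : ∀ i, v i = r i • expv B β + a i • rhoV V + iota B β (d i • H + D i)) :
    (∑ i, muk B (v i) (v i) / d i) ≤
        muk B (∑ i, v i) (∑ i, v i) / (∑ i, d i) ∧
    (∑ i, (muk B (v i) (v i) - B (D i) (D i)) / d i) ≤
        (muk B (∑ i, v i) (∑ i, v i) - B (∑ i, D i) (∑ i, D i)) / (∑ i, d i) := by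
  have : Nonempty (Fin s) := ⟨⟨0, hs⟩⟩
  have hdpos : 0 < ∑ i, d i := Finset.sum_pos (fun i _ => hd i) Finset.univ_nonempty
  have hHD : ∀ (c : ℝ) (E : V), B E H = 0 →
      B (c • H + E) (c • H + E) = c ^ 2 * B H H + B E E := by
    intro c E hE
    simp only [map_add, map_smul, LinearMap.add_apply, LinearMap.smul_apply, smul_eq_mul,
      hB H E, hE]
    ring
  have hDsum : B (∑ i, D i) H = 0 := by simp [LinearMap.sum_apply, hD]
  have ha : ∀ i, a i = r i * t - lam * d i := fun i => by linarith [hphase i]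
  have hself : ∀ i, muk B (v i) (v i) =
      d i ^ 2 * B H H - 2 * r i * (r i * t - lam * d i) + B (D i) (D i) := by
    intro i
    rw [hv, muk_self_coord B hB, hHD _ _ (hD i), ← ha]
    ring
  have hasum : ∑ i, a i = (∑ i, r i) * t - lam * ∑ i, d i := by
    simp only [ha, Finset.sum_sub_distrib, Finset.sum_mul, Finset.mul_sum]
  have htot : muk B (∑ i, v i) (∑ i, v i) =
      (∑ i, d i) ^ 2 * B H H - 2 * (∑ i, r i) * ((∑ i, r i) * t - lam * ∑ i, d i) +
        B (∑ i, D i) (∑ i, D i) := by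
    simp only [hv]
    rw [sum_coord, muk_self_coord B hB, Finset.sum_add_distrib, ← Finset.sum_smul,
      hHD _ _ hDsum, ← hasum]
    ring
  have hD_le : ∑ i, B (D i) (D i) / d i ≤ B (∑ i, D i) (∑ i, D i) / ∑ i, d i :=
    sum_form_div_le B hB (LinearMap.ker (B.flip H)) (fun x hx => hsemi x (by simpa using hx))
      Finset.univ d D (fun i _ => hd i) (fun i _ => by simpa using hD i)
  have hr_le : (∑ i, r i) ^ 2 / ∑ i, d i ≤ ∑ i, r i ^ 2 / d i :=
    Finset.sq_sum_div_le_sum_sq_div _ _ (fun i _ => hd i)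
  have hdivide : ∀ c ρ : ℝ, 0 < c → (c ^ 2 * B H H - 2 * ρ * (ρ * t - lam * c)) / c =
      c * B H H + 2 * lam * ρ - 2 * t * (ρ ^ 2 / c) := by
    intro c ρ hc
    field_simp
    ring
  have hmain : ∑ i, (muk B (v i) (v i) - B (D i) (D i)) / d i ≤
      (muk B (∑ i, v i) (∑ i, v i) - B (∑ i, D i) (∑ i, D i)) / ∑ i, d i := by
    simp only [hself, htot, add_sub_cancel_right]
    rw [hdivide _ _ hdpos, Finset.sum_congr rfl fun i _ => hdivide _ (r i) (hd i),
      Finset.sum_sub_distrib, Finset.sum_add_distrib, ← Finset.sum_mul, ← Finset.mul_sum,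
      ← Finset.mul_sum]
    have := mul_le_mul_of_nonneg_left hr_le (by positivity : 0 ≤ 2 * t)
    linarith
  refine ⟨?_, hmain⟩
  simp only [sub_div, Finset.sum_sub_distrib] at hmain
  linarith
end
end

section
/- (Lemma 3.6, lem:large: the large volume limit condition (⋆1)) Fix β ∈ N_ℚ, a nonnegative integer ε, and v ∈ Λ with r_v ≥ 0 and d_v > 0. Then there exists a real number W such that for every real s > W and every u ∈ Λ satisfying 0 < d_u < d_v, ⟨u,u⟩ ≥ −2ε, and d_v·r_u − d_u·r_v > 0, one has (d_v·r_u − d_u·r_v)·s/2 − (d_v·a_u − d_u·a_v) > 0. -/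
noncomputable section

/-- The inclusion of the integral Mukai lattice `Λ = ℤ × N × ℤ` into `ℝ × V × ℝ`. -/
def uR {V : Type*} [AddCommGroup V] [Module ℝ V] (u : ℤ × V × ℤ) : ℝ × V × ℝ :=
  ((u.1 : ℝ), u.2.1, (u.2.2 : ℝ))

/-- `d_u := ⟨u, w_β⟩ / (H,H)` where `w_β := (0, H, (H,β))`. -/
def dcoord {V : Type*} [AddCommGroup V] [Module ℝ V]
    (B : V →ₗ[ℝ] V →ₗ[ℝ] ℝ) (H β : V) (u : ℤ × V × ℤ) : ℝ :=
  muk B (uR u) (0, H, B H β) / B H H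

/-- `a_u := -⟨e^β, u⟩`. -/
def acoord {V : Type*} [AddCommGroup V] [Module ℝ V]
    (B : V →ₗ[ℝ] V →ₗ[ℝ] ℝ) (β : V) (u : ℤ × V × ℤ) : ℝ :=
  -muk B (expv B β) (uR u)
/-- Hodge index inequality: `(y,y)(H,H) ≤ (y,H)²` when the form is negative definite on `H^⊥`. -/
theorem hodge_index {V : Type*} [AddCommGroup V] [Module ℝ V]
    (B : V →ₗ[ℝ] V →ₗ[ℝ] ℝ) (hB : ∀ x y, B x y = B y x)
    (H : V) (hH : 0 < B H H)
    (hneg : ∀ x : V, B x H = 0 → x ≠ 0 → B x x < 0) (y : V) :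
    B y y ≤ (B y H / B H H) ^ 2 * B H H := by
  set c := B y H / B H H with hc
  have hcH : B y H = c * B H H := by rw [hc]; field_simp
  have hperp : B (y - c • H) H = 0 := by simp [hcH]
  have hle : B (y - c • H) (y - c • H) ≤ 0 := by
    by_cases h0 : y - c • H = 0
    · simp [h0]
    · exact (hneg _ hperp h0).le
  simp only [map_sub, map_smul, LinearMap.sub_apply, LinearMap.smul_apply, smul_eq_mul,
    hB H y, hcH] at hle
  nlinarith

/-- The self-pairing of `u` bounds `r_u a_u` from above in terms of `d_u`. -/
theorem two_mul_rank_mul_acoord_le {V : Type*} [AddCommGroup V] [Module ℝ V]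
    (B : V →ₗ[ℝ] V →ₗ[ℝ] ℝ) (hB : ∀ x y, B x y = B y x)
    (H : V) (hH : 0 < B H H)
    (hneg : ∀ x : V, B x H = 0 → x ≠ 0 → B x x < 0) (β : V) (u : ℤ × V × ℤ) :
    2 * (u.1 : ℝ) * acoord B β u ≤
      dcoord B H β u ^ 2 * B H H - muk B (uR u) (uR u) := by
  have h := hodge_index B hB H hH hneg (u.2.1 - (u.1 : ℝ) • β)
  have hd : B (u.2.1 - (u.1 : ℝ) • β) H / B H H = dcoord B H β u := by
    simp [dcoord, muk, uR, hB H β]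
  rw [hd] at h
  simp only [map_sub, map_smul, LinearMap.sub_apply, LinearMap.smul_apply, smul_eq_mul,
    hB u.2.1 β] at h
  simp only [acoord, muk, uR, expv]
  linarith

/-- The numbers `d_u` lie in `(m (H,H))⁻¹ ℤ` when `m β` is integral. -/
theorem exists_int_eq_dcoord_mul {V : Type*} [AddCommGroup V] [Module ℝ V]
    (B : V →ₗ[ℝ] V →ₗ[ℝ] ℝ) (L : Submodule ℤ V)
    (hint : ∀ x ∈ L, ∀ y ∈ L, ∃ n : ℤ, B x y = (n : ℝ))
    (H : V) (hHL : H ∈ L) (hH : 0 < B H H)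
    (β : V) (m : ℤ) (hmβ : m • β ∈ L) (u : ℤ × V × ℤ) (hu : u.2.1 ∈ L) :
    ∃ n : ℤ, dcoord B H β u * (m * B H H) = n := by
  obtain ⟨p, hp⟩ := hint _ hu _ hHL
  obtain ⟨q, hq⟩ := hint _ hHL _ hmβ
  rw [map_zsmul, zsmul_eq_mul] at hq
  refine ⟨m * p - u.1 * q, ?_⟩
  have hd : dcoord B H β u * B H H = p - u.1 * B H β := by
    simp [dcoord, muk, uR, hp, hH.ne']
  push_cast
  linear_combination (m : ℝ) * hd - (u.1 : ℝ) * hq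

/-- Lemma 3.6 (lem:large): the large volume limit condition (⋆1). -/
theorem stmt4 {V : Type*} [AddCommGroup V] [Module ℝ V] [FiniteDimensional ℝ V]
    (B : V →ₗ[ℝ] V →ₗ[ℝ] ℝ) (hB : ∀ x y, B x y = B y x)
    (L : Submodule ℤ V)
    (hint : ∀ x ∈ L, ∀ y ∈ L, ∃ n : ℤ, B x y = (n : ℝ))
    (H : V) (hHL : H ∈ L) (hH : 0 < B H H)
    (hneg : ∀ x : V, B x H = 0 → x ≠ 0 → B x x < 0)
    (β : V) (m : ℤ) (hm : 0 < m) (hmβ : m • β ∈ L)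
    (ε : ℕ)
    (v : ℤ × V × ℤ) (hvL : v.2.1 ∈ L)
    (hrv : 0 ≤ v.1) (hdv : 0 < dcoord B H β v) :
    ∃ W : ℝ, ∀ s : ℝ, W < s → ∀ u : ℤ × V × ℤ, u.2.1 ∈ L →
      0 < dcoord B H β u → dcoord B H β u < dcoord B H β v →
      -2 * (ε : ℝ) ≤ muk B (uR u) (uR u) →
      0 < dcoord B H β v * (u.1 : ℝ) - dcoord B H β u * (v.1 : ℝ) →
      0 < (dcoord B H β v * (u.1 : ℝ) - dcoord B H β u * (v.1 : ℝ)) * s / 2 -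
            (dcoord B H β v * acoord B β u - dcoord B H β u * acoord B β v) := by
  obtain ⟨nv, hnv⟩ := exists_int_eq_dcoord_mul B L hint H hHL hH β m hmβ v hvL
  set h := B H H
  set dv := dcoord B H β v
  set av := acoord B β v
  have hmh : 0 < (m : ℝ) * h := mul_pos (by exact_mod_cast hm) hH
  have hrv' : (0 : ℝ) ≤ v.1 := by exact_mod_cast hrv
  set A : ℝ := (dv ^ 2 * h + 2 * ε) / 2 with hA
  have hA0 : 0 ≤ A := by positivity
  set C : ℝ := dv * A + dv * |av| with hC
  have hC0 : 0 ≤ C := by positivity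
  refine ⟨2 * C * (m * h), fun s hs u huL hdu hduv hself hD => ?_⟩
  obtain ⟨nu, hnu⟩ := exists_int_eq_dcoord_mul B L hint H hHL hH β m hmβ u huL
  have hau := two_mul_rank_mul_acoord_le B hB H hH hneg β u
  set du := dcoord B H β u
  set au := acoord B β u
  have hs0 : 0 < s := lt_of_le_of_lt (by positivity) hs
  have hr : (1 : ℝ) ≤ u.1 := by
    have hpos : (0 : ℝ) < u.1 := by
      have : 0 < dv * (u.1 : ℝ) := by nlinarith [mul_nonneg hdu.le hrv']
      exact pos_of_mul_pos_right this hdv.le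
    exact_mod_cast (show (0 : ℤ) < u.1 by exact_mod_cast hpos)
  have hauA : au ≤ A := by
    have hsq : du ^ 2 * h ≤ dv ^ 2 * h := by gcongr
    have hra : (u.1 : ℝ) * au ≤ A := by rw [hA]; linarith
    rcases le_or_gt au 0 with ha | ha
    · exact ha.trans hA0
    · nlinarith
  have hDint : 1 ≤ (dv * (u.1 : ℝ) - du * v.1) * (m * h) := by
    have heq : (dv * (u.1 : ℝ) - du * v.1) * (m * h) = ((nv * u.1 - nu * v.1 : ℤ) : ℝ) := by
      push_cast
      linear_combination (u.1 : ℝ) * hnv - (v.1 : ℝ) * hnu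
    have hpos := mul_pos hD hmh
    rw [heq] at hpos ⊢
    exact_mod_cast (show (0 : ℤ) < _ by exact_mod_cast hpos)
  have hle : dv * au - du * av ≤ C := by
    have h1 : dv * au ≤ dv * A := by gcongr
    have h2 : -(du * av) ≤ dv * |av| :=
      calc -(du * av) = du * -av := by ring
        _ ≤ du * |av| := by gcongr; exact neg_le_abs av
        _ ≤ dv * |av| := by gcongr
    linarith
  have hDs : 2 * C < (dv * (u.1 : ℝ) - du * v.1) * s := by
    have h1 := mul_lt_mul_of_pos_left hs hD
    have h2 := mul_le_mul_of_nonneg_left hDint (by positivity : 0 ≤ 2 * C)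
    linarith
  linarith
end
end

section
/- (Lemma 2.16, lem:R_beta) Fix β ∈ N_ℚ and a positive integer r₀ with r₀·e^β ∈ Λ (i.e. r₀β ∈ N and r₀(β,β)/2 ∈ ℤ). Then the set 𝔯_β := { u ∈ Λ : ⟨u, w_β⟩ = 0, ⟨u,u⟩ = −2, rk u > 0, and −⟨e^β, u⟩ > 0 } is finite, and every u ∈ 𝔯_β satisfies rk u ≤ r₀. -/
noncomputable section

/-- A quadratic form that is negative definite on the orthogonal complement of `H` is bounded
above there by a negative multiple of the squared norm. -/
lemma exists_mul_norm_sq_le_neg_of_orthogonal {V : Type*} [NormedAddCommGroup V]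
    [NormedSpace ℝ V] [FiniteDimensional ℝ V] (B : V →ₗ[ℝ] V →ₗ[ℝ] ℝ) (H : V)
    (hneg : ∀ x : V, B x H = 0 → x ≠ 0 → B x x < 0) :
    ∃ c : ℝ, 0 < c ∧ ∀ x : V, B x H = 0 → c * ‖x‖ ^ 2 ≤ -B x x := by
  have hcont : Continuous fun x : V => -B x x := by
    have h : Continuous fun x : V => -B.toContinuousBilinearMap x x := by fun_prop
    exact h
  have hclosed : IsClosed {x : V | B x H = 0} := by
    have h : Continuous fun x : V => B.toContinuousBilinearMap x H := by fun_prop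
    exact isClosed_eq h continuous_const
  obtain ⟨c, hc, hcle⟩ := ((isCompact_sphere (0 : V) 1).inter_right hclosed).exists_forall_le'
    hcont.continuousOn (a := 0) (by
      rintro x ⟨hx, hxH⟩
      have := hneg x hxH (ne_zero_of_mem_unit_sphere ⟨x, hx⟩)
      linarith)
  refine ⟨c, hc, fun x hx => ?_⟩
  rcases eq_or_ne x 0 with rfl | hx0
  · simp
  have hn : 0 < ‖x‖ := norm_pos_iff.mpr hx0
  have h := hcle (‖x‖⁻¹ • x) ⟨by simp [norm_smul, hn.ne'], by simp [hx]⟩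
  simp only [map_smul, LinearMap.smul_apply, smul_eq_mul] at h
  calc c * ‖x‖ ^ 2 ≤ -(‖x‖⁻¹ * (‖x‖⁻¹ * B x x)) * ‖x‖ ^ 2 := by gcongr
    _ = -B x x := by field_simp

/-- The pairing of `u` with `w_β` is the pairing of its `β`-twisted middle component with `H`. -/
lemma muk_uR_eq_apply_sub {V : Type*} [AddCommGroup V] [Module ℝ V]
    (B : V →ₗ[ℝ] V →ₗ[ℝ] ℝ) (hB : ∀ x y, B x y = B y x) (H β : V) (u : ℤ × V × ℤ) :
    muk B (uR u) (0, H, B H β) = B (u.2.1 - (u.1 : ℝ) • β) H := by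
  simp [muk, uR, hB H β]

/-- The self-pairing of `u` in terms of its `β`-twisted components. -/
lemma muk_uR_self_eq {V : Type*} [AddCommGroup V] [Module ℝ V]
    (B : V →ₗ[ℝ] V →ₗ[ℝ] ℝ) (hB : ∀ x y, B x y = B y x) (β : V) (u : ℤ × V × ℤ) :
    muk B (uR u) (uR u) = B (u.2.1 - (u.1 : ℝ) • β) (u.2.1 - (u.1 : ℝ) • β)
      - 2 * u.1 * -muk B (expv B β) (uR u) := by
  simp only [muk, uR, expv, map_sub, map_smul, LinearMap.sub_apply, LinearMap.smul_apply,
    smul_eq_mul, hB β u.2.1]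
  ring

/-- If `r₀ e^β` is integral then so is `r₀ ⟨e^β, u⟩`. -/
lemma exists_intCast_eq_mul_muk_expv {V : Type*} [AddCommGroup V] [Module ℝ V]
    (B : V →ₗ[ℝ] V →ₗ[ℝ] ℝ) (L : Submodule ℤ V)
    (hint : ∀ x ∈ L, ∀ y ∈ L, ∃ n : ℤ, B x y = (n : ℝ)) (β : V) (r₀ : ℤ)
    (hr₀β : r₀ • β ∈ L) (hr₀β2 : ∃ n : ℤ, (r₀ : ℝ) * B β β / 2 = (n : ℝ))
    (u : ℤ × V × ℤ) (hu : u.2.1 ∈ L) :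
    ∃ n : ℤ, (r₀ : ℝ) * -muk B (expv B β) (uR u) = n := by
  obtain ⟨m, hm⟩ := hint _ hr₀β _ hu
  obtain ⟨n, hn⟩ := hr₀β2
  rw [← Int.cast_smul_eq_zsmul ℝ, map_smul, LinearMap.smul_apply, smul_eq_mul] at hm
  refine ⟨r₀ * u.2.2 + n * u.1 - m, ?_⟩
  push_cast
  rw [← hm, ← hn]
  simp only [muk, uR, expv]
  ring

/-- Lemma 2.16 (lem:R_beta): the set `𝔯_β` is finite and ranks are at most `r₀`. -/
theorem stmt5 {V : Type*} [NormedAddCommGroup V] [NormedSpace ℝ V]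
    [FiniteDimensional ℝ V]
    (B : V →ₗ[ℝ] V →ₗ[ℝ] ℝ) (hB : ∀ x y, B x y = B y x)
    (L : Submodule ℤ V) (hdisc : DiscreteTopology L)
    (hspan : Submodule.span ℝ (L : Set V) = ⊤)
    (hint : ∀ x ∈ L, ∀ y ∈ L, ∃ n : ℤ, B x y = (n : ℝ))
    (H : V) (hHL : H ∈ L) (hH : 0 < B H H)
    (hneg : ∀ x : V, B x H = 0 → x ≠ 0 → B x x < 0)
    (β : V) (r₀ : ℤ) (hr₀ : 0 < r₀)
    (hr₀β : r₀ • β ∈ L) (hr₀β2 : ∃ n : ℤ, (r₀ : ℝ) * B β β / 2 = (n : ℝ)) :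
    {u : ℤ × V × ℤ | u.2.1 ∈ L ∧ muk B (uR u) (0, H, B H β) = 0 ∧
        muk B (uR u) (uR u) = -2 ∧ 0 < u.1 ∧
        0 < -muk B (expv B β) (uR u)}.Finite ∧
    ∀ u : ℤ × V × ℤ, u.2.1 ∈ L → muk B (uR u) (0, H, B H β) = 0 →
      muk B (uR u) (uR u) = -2 → 0 < u.1 →
      0 < -muk B (expv B β) (uR u) → u.1 ≤ r₀ := by
  have hnonpos : ∀ x : V, B x H = 0 → B x x ≤ 0 := fun x hx => by
    rcases eq_or_ne x 0 with rfl | hx0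
    · simp
    · exact (hneg x hx hx0).le
  have hrank : ∀ u : ℤ × V × ℤ, u.2.1 ∈ L → muk B (uR u) (0, H, B H β) = 0 →
      muk B (uR u) (uR u) = -2 → 0 < u.1 →
      0 < -muk B (expv B β) (uR u) → u.1 ≤ r₀ := by
    intro u hu hw hsq hr ha
    obtain ⟨n, hn⟩ := exists_intCast_eq_mul_muk_expv B L hint β r₀ hr₀β hr₀β2 u hu
    rw [muk_uR_eq_apply_sub B hB] at hw
    rw [muk_uR_self_eq B hB β] at hsq
    have hD := hnonpos _ hw
    set a := -muk B (expv B β) (uR u)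
    have hrR : (0 : ℝ) < u.1 := by exact_mod_cast hr
    have hr₀R : (0 : ℝ) < r₀ := by exact_mod_cast hr₀
    have hn1 : (1 : ℝ) ≤ r₀ * a := by
      have : (0 : ℝ) < n := hn ▸ mul_pos hr₀R ha
      rw [hn]
      exact_mod_cast this
    have hra : (u.1 : ℝ) * a ≤ 1 := by linarith
    have : (u.1 : ℝ) ≤ r₀ := by
      calc (u.1 : ℝ) ≤ u.1 * (r₀ * a) := le_mul_of_one_le_right hrR.le hn1
        _ = r₀ * (u.1 * a) := by ring
        _ ≤ r₀ := mul_le_of_le_one_right hr₀R.le hra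
    exact_mod_cast this
  refine ⟨?_, hrank⟩
  obtain ⟨c, hc, hcle⟩ := exists_mul_norm_sq_le_neg_of_orthogonal B H hneg
  have hLclosed : IsClosed (L : Set V) :=
    AddSubgroup.isClosed_of_discrete (H := L.toAddSubgroup)
  have hfin : (Metric.closedBall (0 : V) (2 / c + 1 + r₀ * ‖β‖) ∩ L).Finite :=
    Metric.finite_isBounded_inter_isClosed DiscreteTopology.isDiscrete
      Metric.isBounded_closedBall hLclosed
  refine Set.Finite.of_injOn (f := fun u => (u.1, u.2.1)) ?_ ?_
    ((Set.finite_Icc (1 : ℤ) r₀).prod hfin)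
  · rintro u ⟨hu, hw, hsq, hr, ha⟩
    have hle := hrank u hu hw hsq hr ha
    refine ⟨⟨hr, hle⟩, ?_, hu⟩
    rw [muk_uR_eq_apply_sub B hB] at hw
    rw [muk_uR_self_eq B hB β] at hsq
    have hrR : (0 : ℝ) < u.1 := by exact_mod_cast hr
    have hleR : (u.1 : ℝ) ≤ r₀ := by exact_mod_cast hle
    have hD := hcle _ hw
    set D := u.2.1 - (u.1 : ℝ) • β with hDdef
    have hDsq : ‖D‖ ^ 2 ≤ 2 / c := by
      rw [le_div_iff₀ hc]
      nlinarith [mul_pos hrR ha]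
    have hDn : ‖D‖ ≤ 2 / c + 1 := by nlinarith [sq_nonneg (‖D‖ - 1), norm_nonneg D]
    rw [mem_closedBall_zero_iff]
    calc ‖u.2.1‖ = ‖D + (u.1 : ℝ) • β‖ := by rw [hDdef, sub_add_cancel]
      _ ≤ ‖D‖ + ‖(u.1 : ℝ) • β‖ := norm_add_le _ _
      _ = ‖D‖ + u.1 * ‖β‖ := by rw [norm_smul, Real.norm_of_nonneg hrR.le]
      _ ≤ 2 / c + 1 + r₀ * ‖β‖ := by gcongr
  · rintro ⟨r, x, s⟩ ⟨-, -, hsq, hr, -⟩ ⟨r', x', s'⟩ ⟨-, -, hsq', -, -⟩ h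
    obtain ⟨rfl, rfl⟩ := Prod.mk.inj h
    simp only [muk, uR] at hsq hsq' hr
    have hrR : (r : ℝ) ≠ 0 := by exact_mod_cast hr.ne'
    have hs : (s : ℝ) = s' := mul_left_cancel₀ hrR (by linarith)
    rw [Int.cast_injective hs]
end
end

section
/- (Numerical bounds from the proof of Corollary 2.20, cor:Bridgeland) Fix β ∈ N_ℚ and a positive integer r₀ with r₀·e^β ∈ Λ. Let u ∈ Λ satisfy ⟨u, w_β⟩ = 0, r := rk u ≥ 1, a := −⟨e^β, u⟩ > 0, and ⟨u,u⟩ ≥ −2. Then r·a ≤ 1; consequently r ≤ r₀ and 1/(r₀·r) ≤ a/r ≤ 1/r², so in particular 1/r₀² ≤ −⟨e^β,u⟩/(rk u) ≤ 1. -/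
noncomputable section

/-- `⟨u,u⟩ + 2 · rk u · a_u` is the square of `u.2.1 - (rk u) β`. -/
lemma muk_self_add_two_mul_acoord {V : Type*} [AddCommGroup V] [Module ℝ V]
    (B : V →ₗ[ℝ] V →ₗ[ℝ] ℝ) (hB : ∀ x y, B x y = B y x) (β : V) (u : ℤ × V × ℤ) :
    muk B (uR u) (uR u) + 2 * ((u.1 : ℝ) * acoord B β u) =
      B (u.2.1 - (u.1 : ℝ) • β) (u.2.1 - (u.1 : ℝ) • β) := by
  simp only [muk, uR, acoord, expv, map_sub, map_smul, LinearMap.sub_apply,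
    LinearMap.smul_apply, smul_eq_mul, hB u.2.1 β]
  ring

/-- If `r₀ e^β` is integral, then so is `r₀ a_u`. -/
lemma exists_int_mul_acoord_eq {V : Type*} [AddCommGroup V] [Module ℝ V]
    (B : V →ₗ[ℝ] V →ₗ[ℝ] ℝ) (L : Submodule ℤ V)
    (hint : ∀ x ∈ L, ∀ y ∈ L, ∃ n : ℤ, B x y = (n : ℝ))
    (β : V) (r₀ : ℤ) (hr₀β : r₀ • β ∈ L)
    (hr₀β2 : ∃ n : ℤ, (r₀ : ℝ) * B β β / 2 = (n : ℝ))
    (u : ℤ × V × ℤ) (huL : u.2.1 ∈ L) :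
    ∃ k : ℤ, (r₀ : ℝ) * acoord B β u = (k : ℝ) := by
  obtain ⟨n, hn⟩ := hr₀β2
  obtain ⟨m, hm⟩ := hint _ hr₀β _ huL
  rw [map_zsmul, LinearMap.smul_apply, zsmul_eq_mul] at hm
  refine ⟨r₀ * u.2.2 + n * u.1 - m, ?_⟩
  push_cast
  rw [← hn, ← hm]
  simp only [muk, uR, acoord, expv]
  ring

/-- Numerical bounds from the proof of Corollary 2.20 (cor:Bridgeland). -/
theorem stmt6 {V : Type*} [AddCommGroup V] [Module ℝ V] [FiniteDimensional ℝ V]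
    (B : V →ₗ[ℝ] V →ₗ[ℝ] ℝ) (hB : ∀ x y, B x y = B y x)
    (L : Submodule ℤ V)
    (hint : ∀ x ∈ L, ∀ y ∈ L, ∃ n : ℤ, B x y = (n : ℝ))
    (H : V) (hHL : H ∈ L) (hH : 0 < B H H)
    (hsemi : ∀ x : V, B x H = 0 → B x x ≤ 0)
    (β : V) (r₀ : ℤ) (hr₀ : 0 < r₀)
    (hr₀β : r₀ • β ∈ L) (hr₀β2 : ∃ n : ℤ, (r₀ : ℝ) * B β β / 2 = (n : ℝ))
    (u : ℤ × V × ℤ) (huL : u.2.1 ∈ L)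
    (hperp : muk B (uR u) (0, H, B H β) = 0)
    (hrk : 1 ≤ u.1)
    (a : ℝ) (ha : a = acoord B β u) (hapos : 0 < a)
    (hsq : -2 ≤ muk B (uR u) (uR u)) :
    (u.1 : ℝ) * a ≤ 1 ∧ u.1 ≤ r₀ ∧
      1 / ((r₀ : ℝ) * (u.1 : ℝ)) ≤ a / (u.1 : ℝ) ∧
      a / (u.1 : ℝ) ≤ 1 / (u.1 : ℝ) ^ 2 ∧
      1 / (r₀ : ℝ) ^ 2 ≤ a / (u.1 : ℝ) ∧ a / (u.1 : ℝ) ≤ 1 := by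
  have hx : B (u.2.1 - (u.1 : ℝ) • β) H = 0 := by
    simp only [muk, uR] at hperp
    simp only [map_sub, map_smul, LinearMap.sub_apply, LinearMap.smul_apply, smul_eq_mul,
      hB β H]
    linarith
  have hsum := muk_self_add_two_mul_acoord B hB β u
  obtain ⟨k, hk⟩ := exists_int_mul_acoord_eq B L hint β r₀ hr₀β hr₀β2 u huL
  rw [← ha] at hsum hk
  have hra : (u.1 : ℝ) * a ≤ 1 := by linarith [hsemi _ hx]
  have hr : (1 : ℝ) ≤ u.1 := by exact_mod_cast hrk
  have hr₀' : (0 : ℝ) < r₀ := by exact_mod_cast hr₀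
  have hr₀a : 1 ≤ (r₀ : ℝ) * a := by
    have hkpos : (0 : ℝ) < k := hk ▸ mul_pos hr₀' hapos
    rw [hk]
    exact_mod_cast hkpos
  have hrr₀ : (u.1 : ℝ) ≤ r₀ := by
    nlinarith [mul_le_mul_of_nonneg_left hr₀a (zero_le_one.trans hr),
      mul_le_mul_of_nonneg_left hra hr₀'.le]
  have hrpos : (0 : ℝ) < u.1 := by linarith
  have hlower : 1 / ((r₀ : ℝ) * (u.1 : ℝ)) ≤ a / (u.1 : ℝ) := by
    rw [← div_div]
    gcongr
    rwa [div_le_iff₀' hr₀']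
  have hupper : a / (u.1 : ℝ) ≤ 1 / (u.1 : ℝ) ^ 2 := by
    rw [div_le_div_iff₀ hrpos (by positivity)]
    nlinarith
  refine ⟨hra, by exact_mod_cast hrr₀, hlower, hupper, le_trans ?_ hlower, hupper.trans ?_⟩
  · rw [sq]
    gcongr
  · rw [div_le_one (by positivity)]
    exact one_le_pow₀ hr
end
end

section
/- (Lemma 2.15, lem:wall:category-finite: local finiteness of walls for categories) Fix b ∈ ℚ and set 𝔥_ℝ := {(η, ω) : η ∈ N_ℝ, (η,H) = 0, ω ∈ ℝ_{>0}·H}, 𝔯 := { u ∈ Λ : ⟨u, (0, H, b·(H,H))⟩ = 0 and ⟨u,u⟩ = −2 }, and for u ∈ 𝔯 let W_u := {(η,ω) ∈ 𝔥_ℝ : rk(u)·(ω,ω) = −2·⟨e^{bH+η}, u⟩}. Then for every compact subset B of 𝔥_ℝ, the set {u ∈ 𝔯 : W_u ∩ B ≠ ∅} is finite. -/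
noncomputable section

theorem continuous_uncurry_bilin {V : Type*} [NormedAddCommGroup V] [NormedSpace ℝ V]
    [FiniteDimensional ℝ V] (B : V →ₗ[ℝ] V →ₗ[ℝ] ℝ) :
    Continuous fun p : V × V => B p.1 p.2 := by
  change Continuous fun p : V × V => B.toContinuousBilinearMap p.1 p.2
  fun_prop

/-- A form that is negative definite on a subspace is bounded above there by a negative
multiple of the squared norm. -/
theorem exists_pos_mul_norm_sq_le_neg {V : Type*} [NormedAddCommGroup V] [NormedSpace ℝ V]
    [FiniteDimensional ℝ V] (B : V →ₗ[ℝ] V →ₗ[ℝ] ℝ) (W : Submodule ℝ V)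
    (hneg : ∀ x ∈ W, x ≠ 0 → B x x < 0) :
    ∃ c : ℝ, 0 < c ∧ ∀ x ∈ W, c * ‖x‖ ^ 2 ≤ -B x x := by
  have hcont : Continuous fun x : V => -B x x :=
    ((continuous_uncurry_bilin B).comp (continuous_id.prodMk continuous_id)).neg
  have hcomp : IsCompact (Metric.sphere (0 : V) 1 ∩ W) :=
    (isCompact_sphere 0 1).inter_right W.closed_of_finiteDimensional
  obtain ⟨c, hc, hle⟩ := hcomp.exists_forall_le' hcont.continuousOn (a := 0) (by
    rintro x ⟨hx, hxW⟩
    have hx0 : x ≠ 0 := ne_zero_of_mem_unit_sphere ⟨x, hx⟩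
    linarith [hneg x hxW hx0])
  refine ⟨c, hc, fun x hx => ?_⟩
  rcases eq_or_ne x 0 with rfl | hx0
  · simp
  have hn : ‖x‖ ≠ 0 := norm_ne_zero_iff.mpr hx0
  have h := hle (‖x‖⁻¹ • x) ⟨by simp [norm_smul, hn], W.smul_mem _ hx⟩
  simp only [map_smul, LinearMap.smul_apply, smul_eq_mul] at h
  calc c * ‖x‖ ^ 2 ≤ -(‖x‖⁻¹ * (‖x‖⁻¹ * B x x)) * ‖x‖ ^ 2 := by gcongr
    _ = -B x x := by field_simp

/-- Only finitely many points of `ℤ × L × ℤ`, with `L` discrete, lie in a bounded set. -/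
theorem finite_uR_mem_of_isBounded {V : Type*} [NormedAddCommGroup V] [NormedSpace ℝ V]
    [FiniteDimensional ℝ V] (L : Submodule ℤ V) [DiscreteTopology L]
    {S : Set (ℝ × V × ℝ)} (hS : Bornology.IsBounded S) :
    {u : ℤ × V × ℤ | u.2.1 ∈ L ∧ uR u ∈ S}.Finite := by
  obtain ⟨R, hR⟩ := hS.exists_norm_le
  have hprop : ProperSpace V := FiniteDimensional.proper ℝ V
  have hdiscr : DiscreteTopology L.toAddSubgroup := ‹DiscreteTopology L›
  have hclosed : IsClosed (L.toAddSubgroup : Set V) := AddSubgroup.isClosed_of_discrete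
  have hfin : (Metric.closedBall (0 : V) R ∩ (L.toAddSubgroup : Set V)).Finite :=
    Metric.finite_isBounded_inter_isClosed DiscreteTopology.isDiscrete Metric.isBounded_closedBall hclosed
  have hint : ∀ n : ℤ, |(n : ℝ)| ≤ R → n ∈ Set.Icc (-⌈R⌉) ⌈R⌉ := by
    intro n hn
    have h := (abs_le.mp (hn.trans (Int.le_ceil R)))
    exact ⟨by exact_mod_cast h.1, by exact_mod_cast h.2⟩
  refine ((Set.finite_Icc (-⌈R⌉) ⌈R⌉).prod
    (hfin.prod (Set.finite_Icc (-⌈R⌉) ⌈R⌉))).subset ?_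
  rintro ⟨r, x, s⟩ ⟨hx, hu⟩
  have h := hR _ hu
  simp only [uR, Prod.norm_mk, sup_le_iff, Real.norm_eq_abs] at h
  exact ⟨hint r h.1, ⟨by simpa using h.2.1, hx⟩, hint s h.2.2⟩

/-- For `γ = β + η`, the wall equation of a `(-2)`-vector `(r, x, s)` says that
`r² (ω,ω) - (ξ,ξ) = 2` with `ξ = x - r γ`. -/
theorem wall_equation {V : Type*} [AddCommGroup V] [Module ℝ V]
    (B : V →ₗ[ℝ] V →ₗ[ℝ] ℝ) (hB : ∀ x y, B x y = B y x) (r s q : ℝ) (x γ : V)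
    (hsq : muk B (r, x, s) (r, x, s) = -2)
    (hwall : r * q = -2 * muk B (expv B γ) (r, x, s)) :
    r ^ 2 * q - B (x - r • γ) (x - r • γ) = 2 := by
  simp only [muk, expv] at hsq hwall
  simp only [map_sub, map_smul, LinearMap.sub_apply, LinearMap.smul_apply, smul_eq_mul, hB x γ]
  linear_combination r * hwall - hsq

/-- Lemma 2.15 (lem:wall:category-finite): local finiteness of walls for categories. -/
theorem stmt8 {V : Type*} [NormedAddCommGroup V] [NormedSpace ℝ V]
    [FiniteDimensional ℝ V]
    (B : V →ₗ[ℝ] V →ₗ[ℝ] ℝ) (hB : ∀ x y, B x y = B y x)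
    (L : Submodule ℤ V) (hdisc : DiscreteTopology L)
    (hspan : Submodule.span ℝ (L : Set V) = ⊤)
    (hint : ∀ x ∈ L, ∀ y ∈ L, ∃ n : ℤ, B x y = (n : ℝ))
    (H : V) (hHL : H ∈ L) (hH : 0 < B H H)
    (hneg : ∀ x : V, B x H = 0 → x ≠ 0 → B x x < 0)
    (b : ℚ)
    (K : Set (V × V)) (hKc : IsCompact K)
    (hKsub : K ⊆ {p : V × V | B p.1 H = 0 ∧ ∃ t : ℝ, 0 < t ∧ p.2 = t • H}) :
    {u : ℤ × V × ℤ | u.2.1 ∈ L ∧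
        muk B (uR u) (0, H, (b : ℝ) * B H H) = 0 ∧
        muk B (uR u) (uR u) = -2 ∧
        ∃ p ∈ K, (u.1 : ℝ) * B p.2 p.2 =
          -2 * muk B (expv B ((b : ℝ) • H + p.1)) (uR u)}.Finite := by
  obtain ⟨c, hc, hle⟩ := exists_pos_mul_norm_sq_le_neg B (LinearMap.ker (B.flip H))
    (fun x hx hx0 => hneg x hx hx0)
  have hcont := continuous_uncurry_bilin B
  have hcontω : Continuous fun p : V × V => B p.2 p.2 :=
    hcont.comp (continuous_snd.prodMk continuous_snd)
  obtain ⟨m, hm, hmle⟩ := hKc.exists_forall_le' hcontω.continuousOn (a := 0) (by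
    intro p hp
    obtain ⟨-, t, ht, hpt⟩ := hKsub hp
    simp only [hpt, map_smul, LinearMap.smul_apply, smul_eq_mul]
    positivity)
  -- The data `(p, r, ξ)` of a wall meeting `K` vary in a compact set and determine `u`.
  let X : (V × V) × ℝ × V → V := fun z => z.2.1 • ((b : ℝ) • H + z.1.1) + z.2.2
  let F : (V × V) × ℝ × V → ℝ × V × ℝ := fun z =>
    (z.2.1, X z, B ((b : ℝ) • H + z.1.1) (X z)
      - z.2.1 * (B ((b : ℝ) • H + z.1.1) ((b : ℝ) • H + z.1.1) / 2)
      + z.2.1 * B z.1.2 z.1.2 / 2)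
  have hγ : Continuous fun z : (V × V) × ℝ × V => (b : ℝ) • H + z.1.1 := by fun_prop
  have hX : Continuous X := by fun_prop
  have hF : Continuous F := by
    have h1 := hcont.comp (hγ.prodMk hX)
    have h2 := hcont.comp (hγ.prodMk hγ)
    have h3 := hcontω.comp (continuous_fst (X := V × V) (Y := ℝ × V))
    have hr : Continuous fun z : (V × V) × ℝ × V => z.2.1 := by fun_prop
    exact hr.prodMk (hX.prodMk ((h1.sub (hr.mul (h2.div_const 2))).add
      ((hr.mul h3).div_const 2)))
  have hprop : ProperSpace V := FiniteDimensional.proper ℝ V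
  have hcomp : IsCompact (F '' (K ×ˢ (Metric.closedBall (0 : ℝ) √(2 / m) ×ˢ
      Metric.closedBall (0 : V) √(2 / c)))) :=
    (hKc.prod ((isCompact_closedBall _ _).prod (isCompact_closedBall _ _))).image hF
  refine (finite_uR_mem_of_isBounded L hcomp.isBounded).subset ?_
  rintro ⟨r, x, s⟩ ⟨hxL, hperp, hsq, p, hpK, hwall⟩
  refine ⟨hxL, (p, (r : ℝ), x - (r : ℝ) • ((b : ℝ) • H + p.1)), ⟨hpK, ?_, ?_⟩, ?_⟩
  all_goals
    have heq := wall_equation B hB r s (B p.2 p.2) x ((b : ℝ) • H + p.1) hsq hwall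
    have hξ : x - (r : ℝ) • ((b : ℝ) • H + p.1) ∈ LinearMap.ker (B.flip H) := by
      simp only [muk, uR] at hperp
      simp only [LinearMap.mem_ker, LinearMap.flip_apply, map_sub, map_add, map_smul,
        smul_eq_mul, (hKsub hpK).1]
      linear_combination hperp
    have hξle := hle _ hξ
    have hrle : m * (r : ℝ) ^ 2 ≤ (r : ℝ) ^ 2 * B p.2 p.2 := by
      nlinarith [hmle p hpK, sq_nonneg (r : ℝ)]
  · rw [mem_closedBall_zero_iff, Real.norm_eq_abs]
    refine Real.abs_le_sqrt ((le_div_iff₀ hm).mpr ?_)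
    nlinarith [mul_nonneg hc.le (sq_nonneg ‖x - (r : ℝ) • ((b : ℝ) • H + p.1)‖)]
  · rw [mem_closedBall_zero_iff]
    refine Real.le_sqrt_of_sq_le ((le_div_iff₀ hc).mpr ?_)
    nlinarith [mul_nonneg hm.le (sq_nonneg (r : ℝ))]
  · simp only [muk, expv, uR] at hwall
    simp only [F, X, uR, add_sub_cancel]
    refine Prod.ext rfl (Prod.ext rfl ?_)
    linear_combination hwall / 2
end
end

section
/- (Lemma 4.4, lem:wall:stability-finite: local finiteness of walls for stabilities) Fix b ∈ ℚ, ε ∈ {0,1}, and a rational number d_min > 0 such that ⟨u, w⟩/(H,H) ∈ ℤ·d_min for every u ∈ Λ, where w := (0, H, b·(H,H)); for u ∈ Λ set d_u := ⟨u, w⟩/(H,H). Fix v ∈ Λ with d := d_v > 0 and r := rk v. For v₁ ∈ Λ put r₁ := rk v₁, d₁ := d_{v₁}, and W_{v₁} := {(η,ω) ∈ 𝔥_ℝ : (ω,ω)·(d·r₁ − d₁·r) = 2·(−d·⟨e^{bH+η}, v₁⟩ + d₁·⟨e^{bH+η}, v⟩)}. Then for every compact subset B of 𝔥_ℝ, the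 set of v₁ ∈ Λ satisfying (a) 0 < d₁ < d, (b) ⟨v₁,v₁⟩ < (d₁/d)·⟨v,v⟩ + 2d·d₁·ε/d_min², (c) ⟨v₁,v₁⟩ ≥ −2d₁²·ε/d_min², and W_{v₁} ∩ B ≠ ∅, is finite. -/
noncomputable section

/-- On a compact parameter space, a family of positive definite quadratic functions dominated by a
constant plus a family of homogeneous functions of degree one confines its variable to a bounded
set. -/
theorem exists_norm_le_of_quadratic_le {X W : Type*} [TopologicalSpace X] [NormedAddCommGroup W]
    [NormedSpace ℝ W] [FiniteDimensional ℝ W] {K : Set X} (hK : IsCompact K)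
    {q l : X → W → ℝ} (hq : Continuous fun z : X × W => q z.1 z.2)
    (hl : Continuous fun z : X × W => l z.1 z.2)
    (hqs : ∀ x (s : ℝ) w, q x (s • w) = s ^ 2 * q x w)
    (hls : ∀ x (s : ℝ) w, l x (s • w) = s * l x w)
    (hpos : ∀ x ∈ K, ∀ w ≠ 0, 0 < q x w) (C : ℝ) :
    ∃ M : ℝ, ∀ x ∈ K, ∀ w, q x w ≤ C + l x w → ‖w‖ ≤ M := by
  have hS : IsCompact (K ×ˢ Metric.sphere (0 : W) 1) := hK.prod (isCompact_sphere _ _)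
  obtain ⟨m, hm, hmq⟩ : ∃ m : ℝ, 0 < m ∧ ∀ z ∈ K ×ˢ Metric.sphere (0 : W) 1, m ≤ q z.1 z.2 := by
    refine hS.exists_forall_le' hq.continuousOn (a := 0) fun z hz => hpos _ hz.1 _ ?_
    exact Metric.ne_of_mem_sphere hz.2 one_ne_zero
  obtain ⟨c, hc⟩ := hS.bddAbove_image hl.continuousOn
  refine ⟨max 1 ((|C| + |c|) / m), fun x hx w h => ?_⟩
  by_cases h1 : ‖w‖ ≤ 1
  · exact h1.trans (le_max_left _ _)
  push Not at h1
  have h0 : ‖w‖ ≠ 0 := by positivity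
  set e : W := ‖w‖⁻¹ • w with he
  have hew : w = ‖w‖ • e := by rw [he, smul_smul, mul_inv_cancel₀ h0, one_smul]
  have hemem : (x, e) ∈ K ×ˢ Metric.sphere (0 : W) 1 := by
    refine ⟨hx, ?_⟩
    simp [he, norm_smul, h0]
  have hqe : m ≤ q x e := hmq _ hemem
  have hle : l x e ≤ c := hc ⟨_, hemem, rfl⟩
  replace h : ‖w‖ ^ 2 * q x e ≤ C + ‖w‖ * l x e := by rwa [← hqs, ← hls, ← hew]
  refine le_trans ?_ (le_max_right _ _)
  rw [le_div_iff₀ hm]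
  have hC : C ≤ ‖w‖ * |C| := by nlinarith [le_abs_self C, abs_nonneg C]
  have hcc : ‖w‖ * l x e ≤ ‖w‖ * |c| :=
    mul_le_mul_of_nonneg_left (hle.trans (le_abs_self c)) (norm_nonneg w)
  have hqq : ‖w‖ ^ 2 * m ≤ ‖w‖ ^ 2 * q x e := mul_le_mul_of_nonneg_left hqe (sq_nonneg _)
  refine le_of_mul_le_mul_left (a := ‖w‖) ?_ (by linarith)
  nlinarith

/-- Only finitely many points of the integral Mukai lattice lie in a compact set. -/
theorem finite_setOf_uR_mem {V : Type*} [NormedAddCommGroup V] [NormedSpace ℝ V]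
    [FiniteDimensional ℝ V] (L : Submodule ℤ V) [DiscreteTopology L]
    {S : Set (ℝ × V × ℝ)} (hS : IsCompact S) :
    {u : ℤ × V × ℤ | u.2.1 ∈ L ∧ uR u ∈ S}.Finite := by
  have hZ : ∀ {T : Set ℝ}, IsCompact T → {n : ℤ | (n : ℝ) ∈ T}.Finite := fun hT =>
    (Int.isClosedEmbedding_coe_real.isCompact_preimage hT).finite_of_discrete
  have hL : (((fun x : ℝ × V × ℝ => x.2.1) '' S) ∩ (L : Set V)).Finite :=
    haveI : DiscreteTopology L.toAddSubgroup := ‹DiscreteTopology L›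
    Metric.finite_isBounded_inter_isClosed (s := (L : Set V)) DiscreteTopology.isDiscrete
      (hS.image (by fun_prop)).isBounded (AddSubgroup.isClosed_of_discrete (H := L.toAddSubgroup))
  refine ((hZ (hS.image (f := fun x : ℝ × V × ℝ => x.1) (by fun_prop))).prod
    (hL.prod (hZ (hS.image (f := fun x : ℝ × V × ℝ => x.2.2) (by fun_prop))))).subset ?_
  rintro u ⟨huL, huS⟩
  exact ⟨⟨_, huS, rfl⟩, ⟨⟨_, huS, rfl⟩, huL⟩, ⟨_, huS, rfl⟩⟩

/-- The vector `R e^β + (0, E, (E,β)) + R (ω,ω)/2 ϱ`, where `s = (ω,ω)`: the general vector of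
vanishing `H`-degree, for `(E,H) = 0`, whose `ϱ`-coordinate lies on the wall. -/
def wallVec {V : Type*} [AddCommGroup V] [Module ℝ V]
    (B : V →ₗ[ℝ] V →ₗ[ℝ] ℝ) (β : V) (s R : ℝ) (E : V) : ℝ × V × ℝ :=
  (R, E + R • β, B E β + R * (B β β / 2) + R * s / 2)

theorem muk_wallVec_self {V : Type*} [AddCommGroup V] [Module ℝ V]
    (B : V →ₗ[ℝ] V →ₗ[ℝ] ℝ) (hB : ∀ x y, B x y = B y x) (β : V) (s R : ℝ) (E : V) :
    muk B (wallVec B β s R E) (wallVec B β s R E) = B E E - s * R ^ 2 := by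
  simp only [muk, wallVec, map_add, map_smul, LinearMap.add_apply, LinearMap.smul_apply,
    smul_eq_mul, hB β E]
  ring

theorem wallVec_smul {V : Type*} [AddCommGroup V] [Module ℝ V]
    (B : V →ₗ[ℝ] V →ₗ[ℝ] ℝ) (β : V) (s c R : ℝ) (E : V) :
    wallVec B β s (c * R) (c • E) = c • wallVec B β s R E := by
  simp only [wallVec, Prod.smul_mk, smul_eq_mul, smul_add, smul_smul, map_smul,
    LinearMap.smul_apply, Prod.mk.injEq, true_and]
  ring

theorem eq_wallVec {V : Type*} [AddCommGroup V] [Module ℝ V]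
    (B : V →ₗ[ℝ] V →ₗ[ℝ] ℝ) (hB : ∀ x y, B x y = B y x) (β : V) (s : ℝ) (u : ℝ × V × ℝ)
    (hu : s * u.1 = -(2 * muk B (expv B β) u)) :
    u = wallVec B β s u.1 (u.2.1 - u.1 • β) := by
  obtain ⟨R, x, a⟩ := u
  simp only [wallVec, muk, expv, sub_add_cancel, Prod.mk.injEq, true_and, map_sub, map_smul,
    LinearMap.sub_apply, LinearMap.smul_apply, smul_eq_mul, hB x β] at hu ⊢
  linarith

theorem muk_add_smul_self {V : Type*} [AddCommGroup V] [Module ℝ V]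
    (B : V →ₗ[ℝ] V →ₗ[ℝ] ℝ) (hB : ∀ x y, B x y = B y x) (x y : ℝ × V × ℝ) (t : ℝ) :
    muk B (x + t • y) (x + t • y) = muk B x x + 2 * t * muk B y x + t ^ 2 * muk B y y := by
  simp only [muk, Prod.fst_add, Prod.snd_add, Prod.smul_fst, Prod.smul_snd, map_add, map_smul,
    LinearMap.add_apply, LinearMap.smul_apply, smul_eq_mul, hB x.2.1 y.2.1]
  ring

theorem muk_smul_right {V : Type*} [AddCommGroup V] [Module ℝ V]
    (B : V →ₗ[ℝ] V →ₗ[ℝ] ℝ) (x y : ℝ × V × ℝ) (c : ℝ) :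
    muk B x (c • y) = c * muk B x y := by
  simp only [muk, Prod.smul_fst, Prod.smul_snd, map_smul, smul_eq_mul]
  ring

theorem muk_sub_smul_right {V : Type*} [AddCommGroup V] [Module ℝ V]
    (B : V →ₗ[ℝ] V →ₗ[ℝ] ℝ) (x y z : ℝ × V × ℝ) (c : ℝ) :
    muk B x (y - c • z) = muk B x y - c * muk B x z := by
  simp only [muk, Prod.fst_sub, Prod.snd_sub, Prod.smul_fst, Prod.smul_snd, map_sub, map_smul,
    smul_eq_mul]
  ring

theorem dcoord_mul {V : Type*} [AddCommGroup V] [Module ℝ V]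
    (B : V →ₗ[ℝ] V →ₗ[ℝ] ℝ) {H : V} (hH : 0 < B H H) (β : V) (u : ℤ × V × ℤ) :
    dcoord B H β u * B H H = B u.2.1 H - u.1 * B H β := by
  simp [dcoord, muk, uR, hH.ne']

theorem continuous_bilin {V : Type*} [NormedAddCommGroup V] [NormedSpace ℝ V]
    [FiniteDimensional ℝ V] (B : V →ₗ[ℝ] V →ₗ[ℝ] ℝ) {X : Type*} [TopologicalSpace X]
    {f g : X → V} (hf : Continuous f) (hg : Continuous g) : Continuous fun x => B (f x) (g x) :=
  (B.toContinuousBilinearMap.continuous.comp hf).clm_apply hg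

theorem continuous_wallVec {V : Type*} [NormedAddCommGroup V] [NormedSpace ℝ V]
    [FiniteDimensional ℝ V] (B : V →ₗ[ℝ] V →ₗ[ℝ] ℝ) {X : Type*} [TopologicalSpace X]
    {β E : X → V} {s R : X → ℝ} (hβ : Continuous β) (hs : Continuous s) (hR : Continuous R)
    (hE : Continuous E) : Continuous fun x => wallVec B (β x) (s x) (R x) (E x) :=
  hR.prodMk ((hE.add (hR.smul hβ)).prodMk (((continuous_bilin B hE hβ).add
    (hR.mul ((continuous_bilin B hβ hβ).div_const 2))).add ((hR.mul hs).div_const 2)))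

theorem continuous_muk {V : Type*} [NormedAddCommGroup V] [NormedSpace ℝ V]
    [FiniteDimensional ℝ V] (B : V →ₗ[ℝ] V →ₗ[ℝ] ℝ) {X : Type*} [TopologicalSpace X]
    {f g : X → ℝ × V × ℝ} (hf : Continuous f) (hg : Continuous g) :
    Continuous fun x => muk B (f x) (g x) :=
  ((continuous_bilin B hf.snd.fst hg.snd.fst).sub (hf.fst.mul hg.snd.snd)).sub
    (hf.snd.snd.mul hg.fst)

/-- Lemma 4.4 (lem:wall:stability-finite): local finiteness of walls for stabilities. -/
theorem stmt9 {V : Type*} [NormedAddCommGroup V] [NormedSpace ℝ V]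
    [FiniteDimensional ℝ V]
    (B : V →ₗ[ℝ] V →ₗ[ℝ] ℝ) (hB : ∀ x y, B x y = B y x)
    (L : Submodule ℤ V) (hdisc : DiscreteTopology L)
    (hspan : Submodule.span ℝ (L : Set V) = ⊤)
    (hint : ∀ x ∈ L, ∀ y ∈ L, ∃ n : ℤ, B x y = (n : ℝ))
    (H : V) (hHL : H ∈ L) (hH : 0 < B H H)
    (hneg : ∀ x : V, B x H = 0 → x ≠ 0 → B x x < 0)
    (b : ℚ) (ε : ℤ) (hε : ε = 0 ∨ ε = 1)
    (dmin : ℚ) (hdmin : 0 < dmin)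
    (hquant : ∀ u : ℤ × V × ℤ, u.2.1 ∈ L →
      ∃ k : ℤ, dcoord B H ((b : ℝ) • H) u = (k : ℝ) * (dmin : ℝ))
    (v : ℤ × V × ℤ) (hvL : v.2.1 ∈ L)
    (hdv : 0 < dcoord B H ((b : ℝ) • H) v)
    (K : Set (V × V)) (hKc : IsCompact K)
    (hKsub : K ⊆ {p : V × V | B p.1 H = 0 ∧ ∃ t : ℝ, 0 < t ∧ p.2 = t • H}) :
    {v₁ : ℤ × V × ℤ | v₁.2.1 ∈ L ∧
        0 < dcoord B H ((b : ℝ) • H) v₁ ∧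
        dcoord B H ((b : ℝ) • H) v₁ < dcoord B H ((b : ℝ) • H) v ∧
        muk B (uR v₁) (uR v₁) <
          (dcoord B H ((b : ℝ) • H) v₁ / dcoord B H ((b : ℝ) • H) v) *
              muk B (uR v) (uR v) +
            2 * dcoord B H ((b : ℝ) • H) v * dcoord B H ((b : ℝ) • H) v₁ *
              (ε : ℝ) / (dmin : ℝ) ^ 2 ∧
        -2 * dcoord B H ((b : ℝ) • H) v₁ ^ 2 * (ε : ℝ) / (dmin : ℝ) ^ 2 ≤
          muk B (uR v₁) (uR v₁) ∧
        ∃ p ∈ K, B p.2 p.2 *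
            (dcoord B H ((b : ℝ) • H) v * (v₁.1 : ℝ) -
              dcoord B H ((b : ℝ) • H) v₁ * (v.1 : ℝ)) =
          2 * (-(dcoord B H ((b : ℝ) • H) v) *
              muk B (expv B ((b : ℝ) • H + p.1)) (uR v₁) +
            dcoord B H ((b : ℝ) • H) v₁ *
              muk B (expv B ((b : ℝ) • H + p.1)) (uR v))}.Finite := by
  set d := dcoord B H ((b : ℝ) • H) v with hd
  -- The parameters are `(t, p)` with `t = d₁ / d`; the unknown is `(R, E)` with `E ∈ H^⊥`.
  let f : (ℝ × V × V) → ℝ × LinearMap.ker (B.flip H) → ℝ × V × ℝ := fun x w =>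
    wallVec B ((b : ℝ) • H + x.2.1) (B x.2.2 x.2.2) w.1 w.2
  have hf : Continuous fun z : (ℝ × V × V) × ℝ × LinearMap.ker (B.flip H) => f z.1 z.2 :=
    continuous_wallVec B
      (by fun_prop) (continuous_bilin B (by fun_prop) (by fun_prop))
      (by fun_prop) (by fun_prop)
  have hfs : ∀ x (s : ℝ) w, f x (s • w) = s • f x w := fun x s w => wallVec_smul B _ _ s w.1 w.2
  have hKK : IsCompact (Set.Icc (0 : ℝ) 1 ×ˢ K) := isCompact_Icc.prod hKc
  obtain ⟨M, hM⟩ := exists_norm_le_of_quadratic_le hKK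
    (q := fun x w => -muk B (f x w) (f x w)) (l := fun x w => 2 * x.1 * muk B (uR v) (f x w))
    (continuous_muk B hf hf).neg
    (Continuous.mul (by fun_prop) (continuous_muk B continuous_const hf))
    (fun x s w => by
      have h := muk_add_smul_self B hB 0 (f x w) s
      rw [zero_add] at h
      simp only [hfs, h]
      simp only [muk, Prod.fst_zero, Prod.snd_zero, map_zero]
      ring)
    (fun x s w => by simp only [hfs, muk_smul_right]; ring)
    (by
      rintro ⟨t, η, ω⟩ ⟨-, hp⟩ ⟨R, E, hE⟩ hw
      obtain ⟨-, τ, hτ, hωH⟩ := hKsub hp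
      simp only at hωH
      have hωω : 0 < B ω ω := by
        rw [hωH]
        simp only [map_smul, LinearMap.smul_apply, smul_eq_mul]
        positivity
      simp only [f, muk_wallVec_self B hB]
      by_cases h0 : E = 0
      · have hR : R ≠ 0 := by
          rintro rfl
          subst h0
          exact hw rfl
        simp only [h0, map_zero]
        have : 0 < B ω ω * R ^ 2 := by positivity
        linarith
      · have := hneg E hE h0
        have : 0 ≤ B ω ω * R ^ 2 := by positivity
        linarith)
    (|muk B (uR v) (uR v)| + 2 * d ^ 2 * ε / (dmin : ℝ) ^ 2)
  have hS : IsCompact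
      ((fun z : (ℝ × V × V) × ℝ × LinearMap.ker (B.flip H) => f z.1 z.2 + z.1.1 • uR v) ''
      ((Set.Icc (0 : ℝ) 1 ×ˢ K) ×ˢ Metric.closedBall (0 : ℝ × LinearMap.ker (B.flip H)) M)) :=
    (hKK.prod (isCompact_closedBall _ _)).image (by fun_prop)
  refine (finite_setOf_uR_mem L hS).subset ?_
  rintro v₁ ⟨hv₁L, hd₁, hd₁d, -, hlow, ⟨η, ω⟩, hp, hwall⟩
  refine ⟨hv₁L, ?_⟩
  set d₁ := dcoord B H ((b : ℝ) • H) v₁ with hd₁v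
  set t : ℝ := d₁ / d with ht
  have htd : t * d = d₁ := div_mul_cancel₀ _ hdv.ne'
  have ht0 : 0 ≤ t := by positivity
  have ht1 : t ≤ 1 := (div_le_one hdv).2 hd₁d.le
  obtain ⟨hηH, -⟩ := hKsub hp
  simp only at hηH hwall
  set u : ℝ × V × ℝ := uR v₁ - t • uR v with hu
  set β : V := (b : ℝ) • H + η with hβ
  have huw : u = wallVec B β (B ω ω) u.1 (u.2.1 - u.1 • β) := by
    refine eq_wallVec B hB β _ u ?_
    rw [hu, muk_sub_smul_right]
    simp only [Prod.fst_sub, Prod.smul_fst, uR, smul_eq_mul] at hwall ⊢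
    rw [← htd] at hwall
    refine mul_left_cancel₀ hdv.ne' ?_
    linear_combination hwall
  have hker : u.2.1 - u.1 • β ∈ LinearMap.ker (B.flip H) := by
    have h1 := dcoord_mul B hH ((b : ℝ) • H) v
    have h2 := dcoord_mul B hH ((b : ℝ) • H) v₁
    rw [← hd] at h1
    rw [← hd₁v, ← htd] at h2
    simp only [LinearMap.mem_ker, LinearMap.flip_apply, hu, hβ, uR, Prod.fst_sub, Prod.snd_sub,
      Prod.smul_fst, Prod.smul_snd, map_sub, map_add, map_smul, smul_eq_mul] at h1 h2 hηH ⊢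
    rw [hηH]
    linear_combination t * h1 - h2
  let w : ℝ × LinearMap.ker (B.flip H) := (u.1, ⟨_, hker⟩)
  have hfu : f (t, η, ω) w = u := huw.symm
  have hv₁ : uR v₁ = u + t • uR v := by rw [hu, sub_add_cancel]
  refine ⟨((t, η, ω), w), Set.mk_mem_prod (Set.mk_mem_prod ⟨ht0, ht1⟩ hp) ?_,
    by simp only [hfu, hv₁]⟩
  rw [mem_closedBall_zero_iff]
  refine hM (t, η, ω) ⟨⟨ht0, ht1⟩, hp⟩ w ?_
  simp only [hfu]
  rw [hv₁, muk_add_smul_self B hB] at hlow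
  have hε0 : (0 : ℝ) ≤ ε := by rcases hε with rfl | rfl <;> simp
  have h1 : t ^ 2 * muk B (uR v) (uR v) ≤ |muk B (uR v) (uR v)| :=
    (mul_le_mul_of_nonneg_left (le_abs_self _) (sq_nonneg t)).trans
      (mul_le_of_le_one_left (abs_nonneg _) (pow_le_one₀ ht0 ht1))
  have h2 : 2 * d₁ ^ 2 * ε / (dmin : ℝ) ^ 2 ≤ 2 * d ^ 2 * ε / (dmin : ℝ) ^ 2 := by gcongr
  have h3 : -2 * d₁ ^ 2 * (ε : ℝ) / (dmin : ℝ) ^ 2 = -(2 * d₁ ^ 2 * ε / (dmin : ℝ) ^ 2) := by ring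
  linarith
end
end

section
/- (Lemma 2.32, lem:ADE) Let c > 0 and set g := e^β − c·ϱ and w := (0, H, (H,β)) in M. Then ⟨g,g⟩ = 2c > 0, ⟨w,w⟩ = (H,H) > 0, ⟨g,w⟩ = 0, and the Mukai pairing is negative definite on the orthogonal complement of {g, w}: every nonzero x ∈ M with ⟨x,g⟩ = 0 and ⟨x,w⟩ = 0 satisfies ⟨x,x⟩ < 0. (With c = (ω,ω)/2 and g = v(G_{(β,ω)}), this says that the classes of objects E with deg_G(E) = χ_G(E) = 0 span a negative definite sublattice of the Mukai lattice.) -/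
noncomputable section

/-- Lemma 2.32 (lem:ADE). -/
theorem stmt10 {V : Type*} [AddCommGroup V] [Module ℝ V] [FiniteDimensional ℝ V]
    (B : V →ₗ[ℝ] V →ₗ[ℝ] ℝ) (hB : ∀ x y, B x y = B y x)
    (H β : V) (hH : 0 < B H H)
    (hneg : ∀ x : V, B x H = 0 → x ≠ 0 → B x x < 0)
    (c : ℝ) (hc : 0 < c)
    (g w : ℝ × V × ℝ)
    (hg : g = expv B β - c • rhoV V) (hw : w = (0, H, B H β)) :
    muk B g g = 2 * c ∧ muk B w w = B H H ∧ muk B g w = 0 ∧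
    ∀ x : ℝ × V × ℝ, x ≠ 0 → muk B x g = 0 → muk B x w = 0 → muk B x x < 0 := by
  subst hg hw
  refine ⟨?_, ?_, ?_, ?_⟩
  · simp [muk, expv, rhoV]
    ring
  · simp [muk]
  · simp [muk, expv, rhoV, hB β H]
  · rintro ⟨r, D, s⟩ hx hxg hxw
    simp only [muk, expv, rhoV, Prod.fst_sub, Prod.snd_sub, Prod.smul_fst, Prod.smul_snd,
      smul_eq_mul, smul_zero, sub_zero, mul_zero, mul_one] at hxg hxw ⊢
    have horth : B (D - r • β) H = 0 := by
      simp only [map_sub, map_smul, LinearMap.sub_apply, LinearMap.smul_apply, smul_eq_mul]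
      rw [hB β H]
      linarith
    have hself : B (D - r • β) (D - r • β) = B D D - 2 * r * B D β + r ^ 2 * B β β := by
      simp only [map_sub, map_smul, LinearMap.sub_apply, LinearMap.smul_apply, smul_eq_mul]
      rw [hB β D]
      ring
    have hs : s = B D β - r * (B β β / 2 - c) := by linarith
    have hsq : B D D - r * s - s * r = B (D - r • β) (D - r • β) - 2 * c * r ^ 2 := by
      rw [hself, hs]
      ring
    rw [hsq]
    by_cases hD : D - r • β = 0
    · have hr : r ≠ 0 := by
        rintro rfl
        obtain rfl : D = 0 := by simpa using hD
        exact hx (by simp [hs])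
      have : 0 < 2 * c * r ^ 2 := by positivity
      simpa [hD] using this
    · have := hneg _ horth hD
      have : 0 ≤ 2 * c * r ^ 2 := by positivity
      linarith
end
end

section
/- (Numerical form of Lemma 2.23, lem:eta:a<0) Let r > 0, a ≤ 0, s > 0 be real numbers and η, D ∈ H^⊥. Assume −(η,η) < min{ r²s²/8, s } and (D,D) ≥ 2ra − 2 (the latter says ⟨v,v⟩ ≥ −2 for the Mukai vector v := r·e^β + a·ϱ + ι_β(D), which has degree d = 0). Then −a + (η,D) − (η,η)·r/2 + r·s/2 > 0. (With s = (ω,ω), the left-hand side is the stability function value Z_{(β+η,ω)}(v), so Z_{(β+η,ω)}(v) ∈ ℝ_{>0}.) -/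
noncomputable section

/-- Cauchy–Schwarz for a symmetric bilinear form that is nonpositive on the pencil `t • x + y`. -/
lemma sq_apply_le_of_nonpos {V : Type*} [AddCommGroup V] [Module ℝ V]
    (B : V →ₗ[ℝ] V →ₗ[ℝ] ℝ) (hB : ∀ x y, B x y = B y x) (x y : V)
    (h : ∀ t : ℝ, B (t • x + y) (t • x + y) ≤ 0) :
    B x y ^ 2 ≤ B x x * B y y := by
  have hd : discrim (B x x) (2 * B x y) (B y y) ≤ 0 := by
    refine discrim_le_zero_of_nonpos fun t => ?_
    have ht := h t
    simp only [map_add, map_smul, LinearMap.add_apply, LinearMap.smul_apply, smul_eq_mul,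
      hB y x] at ht
    linarith
  rw [discrim] at hd
  linarith

/-- Numerical form of Lemma 2.23 (lem:eta:a<0). -/
theorem stmt11 {V : Type*} [AddCommGroup V] [Module ℝ V] [FiniteDimensional ℝ V]
    (B : V →ₗ[ℝ] V →ₗ[ℝ] ℝ) (hB : ∀ x y, B x y = B y x)
    (H β : V) (hH : 0 < B H H)
    (hsemi : ∀ x : V, B x H = 0 → B x x ≤ 0)
    (r a s : ℝ) (hr : 0 < r) (ha : a ≤ 0) (hs : 0 < s)
    (η D : V) (hη : B η H = 0) (hD : B D H = 0)
    (hsmall : -(B η η) < min (r ^ 2 * s ^ 2 / 8) s)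
    (hDD : 2 * r * a - 2 ≤ B D D) :
    0 < -a + B η D - B η η * r / 2 + r * s / 2 := by
  have hcs : B η D ^ 2 ≤ B η η * B D D :=
    sq_apply_le_of_nonpos B hB η D fun t => hsemi _ (by simp [hη, hD])
  have he : B η η ≤ 0 := hsemi η hη
  obtain ⟨h₁, h₂⟩ := lt_min_iff.mp hsmall
  generalize B η η = p at *
  generalize B D D = q at *
  generalize B η D = c at *
  have hc : c ^ 2 ≤ -p * (2 - 2 * r * a) := by nlinarith
  have hgap : (r * (s + p) / 2) ^ 2 ≤ (-a + r * (s + p) / 2) ^ 2 := by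
    have : 0 < r * (s + p) := mul_pos hr (by linarith)
    exact pow_le_pow_left₀ (by linarith) (by linarith) 2
  have hsq : c ^ 2 < (-a - p * r / 2 + r * s / 2) ^ 2 := by
    have := mul_nonneg (mul_nonneg (sq_nonneg r) hs.le) (neg_nonneg.mpr he)
    nlinarith [sq_nonneg (r * p)]
  have hpos : 0 ≤ -a - p * r / 2 + r * s / 2 := by
    nlinarith [mul_pos hr hs, mul_nonneg (neg_nonneg.mpr he) hr.le]
  linarith [(abs_lt.mp (abs_lt_of_sq_lt_sq hsq hpos)).1]
end
end

section
/- (Lemma 4.10, lem:bogomolov-estimate) For i = 1,2 let r_i > 0, d_i, a_i ∈ ℝ, D_i ∈ H^⊥, and set v_i := r_i·e^β + a_i·ϱ + ι_β(d_i H + D_i) ∈ M. Assume ⟨v_i,v_i⟩ ≥ −2r_i² for i = 1,2 (the Bogomolov inequality for μ-semistable objects of rank r_i). Then ⟨v₁,v₂⟩ ≥ −(r₂d₁ − r₁d₂)²·(H,H)/(2r₁r₂) − 2r₁r₂. -/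
noncomputable section

/-- The pairing of two vectors written in the form `r e^β + a ϱ + ι_β(ξ)`. -/
theorem muk_expv_add_rhoV_add_iota {V : Type*} [AddCommGroup V] [Module ℝ V]
    (B : V →ₗ[ℝ] V →ₗ[ℝ] ℝ) (hB : ∀ x y, B x y = B y x) (β ξ₁ ξ₂ : V) (r₁ a₁ r₂ a₂ : ℝ) :
    muk B (r₁ • expv B β + a₁ • rhoV V + iota B β ξ₁)
        (r₂ • expv B β + a₂ • rhoV V + iota B β ξ₂) =
      B ξ₁ ξ₂ - r₁ * a₂ - r₂ * a₁ := by
  simp [muk, expv, rhoV, iota, hB β ξ₂]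
  ring

/-- Lemma 4.10 (lem:bogomolov-estimate). -/
theorem stmt12 {V : Type*} [AddCommGroup V] [Module ℝ V] [FiniteDimensional ℝ V]
    (B : V →ₗ[ℝ] V →ₗ[ℝ] ℝ) (hB : ∀ x y, B x y = B y x)
    (H β : V) (hH : 0 < B H H)
    (hsemi : ∀ x : V, B x H = 0 → B x x ≤ 0)
    (r₁ a₁ d₁ r₂ a₂ d₂ : ℝ) (hr₁ : 0 < r₁) (hr₂ : 0 < r₂)
    (D₁ D₂ : V) (hD₁ : B D₁ H = 0) (hD₂ : B D₂ H = 0)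
    (v₁ v₂ : ℝ × V × ℝ)
    (hv₁ : v₁ = r₁ • expv B β + a₁ • rhoV V + iota B β (d₁ • H + D₁))
    (hv₂ : v₂ = r₂ • expv B β + a₂ • rhoV V + iota B β (d₂ • H + D₂))
    (hbog₁ : -2 * r₁ ^ 2 ≤ muk B v₁ v₁) (hbog₂ : -2 * r₂ ^ 2 ≤ muk B v₂ v₂) :
    -((r₂ * d₁ - r₁ * d₂) ^ 2 * B H H) / (2 * r₁ * r₂) - 2 * r₁ * r₂ ≤
      muk B v₁ v₂ := by
  subst hv₁ hv₂
  rw [muk_expv_add_rhoV_add_iota B hB] at hbog₁ hbog₂ ⊢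
  have hD := hsemi (r₂ • D₁ - r₁ • D₂) (by simp [hD₁, hD₂])
  simp only [map_add, map_sub, map_smul, LinearMap.add_apply, LinearMap.sub_apply,
    LinearMap.smul_apply, smul_eq_mul, hD₁, hD₂, hB H D₁, hB H D₂, hB D₂ D₁]
    at hbog₁ hbog₂ hD ⊢
  have hr : 0 < 2 * r₁ * r₂ := by positivity
  rw [sub_le_iff_le_add, div_le_iff₀ hr]
  linear_combination r₂ ^ 2 * hbog₁ + r₁ ^ 2 * hbog₂ + hD
end
end

section
/- (Lemma 5.5(1), lem:codim) For i = 1,2 let r_i, a_i ∈ ℝ, d_i > 0, D_i ∈ H^⊥, and set v_i := r_i·e^β + a_i·ϱ + ι_β(d_i H + D_i) ∈ M. Assume: ⟨v₁,v₂⟩ ∈ ℤ; ⟨v₁,v₁⟩ and ⟨v₂,v₂⟩ are nonnegative even integers; there exist real numbers t > 0 and λ with r_i·t − a_i = λ·d_i for i = 1,2 (equal phases); and d₂r₁ − d₁r₂ ≠ 0. Then either ⟨v₁,v₂⟩ ≥ 3, or ⟨v₁,v₂⟩ ∈ {1,2} and at least one of ⟨v₁,v₁⟩, ⟨v₂,v₂⟩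 equals 0. -/
noncomputable section

/-- The Mukai pairing in the coordinates adapted to `β` and `H`. -/
theorem muk_eq {V : Type*} [AddCommGroup V] [Module ℝ V]
    (B : V →ₗ[ℝ] V →ₗ[ℝ] ℝ) (hB : ∀ x y, B x y = B y x) (H β : V)
    (r a d r' a' d' : ℝ) (D D' : V) (hD : B D H = 0) (hD' : B D' H = 0) :
    muk B (r • expv B β + a • rhoV V + iota B β (d • H + D))
        (r' • expv B β + a' • rhoV V + iota B β (d' • H + D')) =
      d * d' * B H H + B D D' - r * a' - a * r' := by
  have hHD' : B H D' = 0 := by rw [hB, hD']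
  simp only [muk, expv, rhoV, iota, Prod.fst_add, Prod.snd_add, Prod.smul_fst, Prod.smul_snd,
    map_add, map_smul, LinearMap.add_apply, LinearMap.smul_apply, smul_eq_mul, smul_zero,
    add_zero, hD, hHD', hB β H, hB β D']
  ring

/-- Lemma 5.5(1) (lem:codim). -/
theorem stmt13 {V : Type*} [AddCommGroup V] [Module ℝ V] [FiniteDimensional ℝ V]
    (B : V →ₗ[ℝ] V →ₗ[ℝ] ℝ) (hB : ∀ x y, B x y = B y x)
    (H β : V) (hH : 0 < B H H)
    (hsemi : ∀ x : V, B x H = 0 → B x x ≤ 0)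
    (r₁ a₁ d₁ r₂ a₂ d₂ : ℝ) (hd₁ : 0 < d₁) (hd₂ : 0 < d₂)
    (D₁ D₂ : V) (hD₁ : B D₁ H = 0) (hD₂ : B D₂ H = 0)
    (v₁ v₂ : ℝ × V × ℝ)
    (hv₁ : v₁ = r₁ • expv B β + a₁ • rhoV V + iota B β (d₁ • H + D₁))
    (hv₂ : v₂ = r₂ • expv B β + a₂ • rhoV V + iota B β (d₂ • H + D₂))
    (hint : ∃ n : ℤ, muk B v₁ v₂ = (n : ℝ))
    (heven₁ : ∃ k : ℤ, 0 ≤ k ∧ muk B v₁ v₁ = 2 * (k : ℝ))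
    (heven₂ : ∃ k : ℤ, 0 ≤ k ∧ muk B v₂ v₂ = 2 * (k : ℝ))
    (t lam : ℝ) (ht : 0 < t)
    (hph₁ : r₁ * t - a₁ = lam * d₁) (hph₂ : r₂ * t - a₂ = lam * d₂)
    (hne : d₂ * r₁ - d₁ * r₂ ≠ 0) :
    3 ≤ muk B v₁ v₂ ∨
      ((muk B v₁ v₂ = 1 ∨ muk B v₁ v₂ = 2) ∧
        (muk B v₁ v₁ = 0 ∨ muk B v₂ v₂ = 0)) := by
  obtain ⟨n, hn⟩ := hint
  obtain ⟨k, hk0, hk⟩ := heven₁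
  obtain ⟨l, hl0, hl⟩ := heven₂
  have hw : B (d₂ • D₁ - d₁ • D₂) (d₂ • D₁ - d₁ • D₂) ≤ 0 := by
    apply hsemi
    simp [hD₁, hD₂]
  have hexp : B (d₂ • D₁ - d₁ • D₂) (d₂ • D₁ - d₁ • D₂) =
      d₂ ^ 2 * B D₁ D₁ + d₁ ^ 2 * B D₂ D₂ - 2 * d₁ * d₂ * B D₁ D₂ := by
    simp only [map_sub, map_smul, LinearMap.sub_apply, LinearMap.smul_apply, smul_eq_mul,
      hB D₂ D₁]
    ring
  have hpos : 0 < t * (d₂ * r₁ - d₁ * r₂) ^ 2 := by positivity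
  have ha₁ : a₁ = r₁ * t - lam * d₁ := by linarith
  have ha₂ : a₂ = r₂ * t - lam * d₂ := by linarith
  have e₁₂ := muk_eq B hB H β r₁ a₁ d₁ r₂ a₂ d₂ D₁ D₂ hD₁ hD₂
  have e₁₁ := muk_eq B hB H β r₁ a₁ d₁ r₁ a₁ d₁ D₁ D₁ hD₁ hD₁
  have e₂₂ := muk_eq B hB H β r₂ a₂ d₂ r₂ a₂ d₂ D₂ D₂ hD₂ hD₂
  rw [← hv₁, ← hv₂, hn] at e₁₂
  rw [← hv₁, hk] at e₁₁
  rw [← hv₂, hl] at e₂₂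
  have hdiff : 2 * (d₂ ^ 2 * k + d₁ ^ 2 * l - d₁ * d₂ * n) =
      B (d₂ • D₁ - d₁ • D₂) (d₂ • D₁ - d₁ • D₂) - 2 * (t * (d₂ * r₁ - d₁ * r₂) ^ 2) := by
    rw [hexp]
    subst ha₁ ha₂
    linear_combination d₂ ^ 2 * e₁₁ + d₁ ^ 2 * e₂₂ - 2 * d₁ * d₂ * e₁₂
  have hlt : d₂ ^ 2 * (k : ℝ) + d₁ ^ 2 * l < d₁ * d₂ * n := by linarith
  have hdd : 0 < d₁ * d₂ := mul_pos hd₁ hd₂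
  have hk0' : (0 : ℝ) ≤ k := by exact_mod_cast hk0
  have hl0' : (0 : ℝ) ≤ l := by exact_mod_cast hl0
  have hn0 : 0 < n := by
    have h : 0 < d₁ * d₂ * (n : ℝ) := lt_of_le_of_lt (by positivity) hlt
    exact_mod_cast pos_of_mul_pos_right h hdd.le
  rw [hn, hk, hl]
  by_cases h3 : 3 ≤ n
  · left
    exact_mod_cast h3
  · right
    have hn2 : n ≤ 2 := by omega
    refine ⟨?_, ?_⟩
    · have h : n = 1 ∨ n = 2 := by omega
      exact_mod_cast h
    · by_contra! hkl
      have hk1 : (1 : ℝ) ≤ k := by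
        have h : k ≠ 0 := by
          rintro rfl
          simp at hkl
        exact_mod_cast (by omega : 1 ≤ k)
      have hl1 : (1 : ℝ) ≤ l := by
        have h : l ≠ 0 := by
          rintro rfl
          simp at hkl
        exact_mod_cast (by omega : 1 ≤ l)
      have hn2' : (n : ℝ) ≤ 2 := by exact_mod_cast hn2
      have h₁ : d₂ ^ 2 ≤ d₂ ^ 2 * (k : ℝ) := le_mul_of_one_le_right (sq_nonneg _) hk1
      have h₂ : d₁ ^ 2 ≤ d₁ ^ 2 * (l : ℝ) := le_mul_of_one_le_right (sq_nonneg _) hl1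
      have h₃ : d₁ * d₂ * (n : ℝ) ≤ d₁ * d₂ * 2 := mul_le_mul_of_nonneg_left hn2' hdd.le
      linarith [sq_nonneg (d₁ - d₂), sub_sq d₁ d₂]
end
end

section
/- (Equations (2.18)–(2.20), eq:Phi(exp) and eq:stability-comm, with the following Remark: the action of a Fourier–Mukai transform on the stability parameters) Let β ∈ V, β' ∈ V', and r₀ > 0. Let Φ : M_ℂ → M'_ℂ be a ℂ-linear map such that ⟨Φ(x), Φ(y)⟩' = ⟨x,y⟩ for all x, y ∈ M_ℂ, Φ(e^β) = (1/r₀)·ϱ', and Φ(ϱ) = r₀·e^{β'}. Let η, ω ∈ V with (η,ω) = 0 and c := (η,η) − (ω,ω) ≠ 0 (so c = ((η+√−1ω, η+√−1ω))). Then: (i) there is a unique ẑ ∈ V'_ℂ with Φ((0, η+√−1ω, (η+√−1ω, β))) = −(0, ẑ, (ẑ, β')'); (ii) writing z̃ := η̃ + √−1·ω̃ := −(2/(r₀c))·ẑ with η̃, ω̃ ∈ V', one has Φ(e^{β+η+√−1ω}) = (r₀c/2)·e^{β'+z̃}; (iii) for every x ∈ M_ℂ, ⟨e^{β'+z̃},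 Φ(x)⟩' = (2/(r₀c))·⟨e^{β+η+√−1ω}, x⟩; and (iv) (η̃,ω̃)' = 0 and ((ω̃,ω̃)' − (η̃,η̃)')·((ω,ω) − (η,η)) = 4/r₀². -/
noncomputable section

open scoped TensorProduct

/-- The complexification `V_ℂ := ℂ ⊗[ℝ] V` of `V`, and the natural map `V → V_ℂ`. -/
def toC {V : Type*} [AddCommGroup V] [Module ℝ V] (x : V) : ℂ ⊗[ℝ] V :=
  (1 : ℂ) ⊗ₜ[ℝ] x

/-- The ℂ-bilinear extension of the Mukai pairing to `M_ℂ := ℂ × (ℂ ⊗[ℝ] V) × ℂ`. -/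
def mukC {V : Type*} [AddCommGroup V] [Module ℝ V]
    (B : V →ₗ[ℝ] V →ₗ[ℝ] ℝ) (x y : ℂ × (ℂ ⊗[ℝ] V) × ℂ) : ℂ :=
  LinearMap.BilinForm.baseChange ℂ B x.2.1 y.2.1 - x.1 * y.2.2 - x.2.2 * y.1

/-- `e^z := (1, z, (z,z)/2)` for a complexified class `z ∈ V_ℂ`. -/
def expC {V : Type*} [AddCommGroup V] [Module ℝ V]
    (B : V →ₗ[ℝ] V →ₗ[ℝ] ℝ) (z : ℂ ⊗[ℝ] V) : ℂ × (ℂ ⊗[ℝ] V) × ℂ :=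
  (1, z, LinearMap.BilinForm.baseChange ℂ B z z / 2)

/-- The natural map `M → M_ℂ`. -/
def MtoC {V : Type*} [AddCommGroup V] [Module ℝ V] (x : ℝ × V × ℝ) :
    ℂ × (ℂ ⊗[ℝ] V) × ℂ :=
  ((x.1 : ℂ), toC x.2.1, (x.2.2 : ℂ))

section MukaiComplexification

variable {V : Type*} [AddCommGroup V] [Module ℝ V]

theorem toC_add (x y : V) : toC (x + y) = toC x + toC y :=
  TensorProduct.tmul_add _ _ _

theorem exists_eq_toC_add_I_smul_toC (z : ℂ ⊗[ℝ] V) :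
    ∃ a b : V, z = toC a + Complex.I • toC b := by
  induction z using TensorProduct.induction_on with
  | zero => exact ⟨0, 0, by simp [toC]⟩
  | tmul w v =>
    refine ⟨w.re • v, w.im • v, ?_⟩
    simp only [toC, TensorProduct.smul_tmul', ← TensorProduct.smul_tmul, ← TensorProduct.add_tmul]
    congr 1
    apply Complex.ext <;> simp
  | add x y hx hy =>
    obtain ⟨a, b, rfl⟩ := hx
    obtain ⟨a', b', rfl⟩ := hy
    refine ⟨a + a', b + b', ?_⟩
    simp only [toC_add, smul_add]
    abel

variable (B : V →ₗ[ℝ] V →ₗ[ℝ] ℝ)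

theorem baseChange_toC_toC (x y : V) :
    LinearMap.BilinForm.baseChange ℂ B (toC x) (toC y) = (B x y : ℂ) := by
  simp [toC, LinearMap.BilinForm.baseChange_tmul]

theorem baseChange_comm (hB : ∀ x y, B x y = B y x) (x y : ℂ ⊗[ℝ] V) :
    LinearMap.BilinForm.baseChange ℂ B x y = LinearMap.BilinForm.baseChange ℂ B y x := by
  obtain ⟨a, b, rfl⟩ := exists_eq_toC_add_I_smul_toC x
  obtain ⟨a', b', rfl⟩ := exists_eq_toC_add_I_smul_toC y
  simp only [map_add, map_smul, LinearMap.add_apply, LinearMap.smul_apply, smul_eq_mul,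
    baseChange_toC_toC, hB a', hB b']
  ring

theorem baseChange_self_toC_add_I_smul_toC (hB : ∀ x y, B x y = B y x) (a b : V) :
    LinearMap.BilinForm.baseChange ℂ B (toC a + Complex.I • toC b) (toC a + Complex.I • toC b) =
      ((B a a - B b b : ℝ) : ℂ) + ((2 * B a b : ℝ) : ℂ) * Complex.I := by
  simp only [map_add, map_smul, LinearMap.add_apply, LinearMap.smul_apply, smul_eq_mul,
    baseChange_toC_toC, hB b a]
  push_cast
  linear_combination (B b b : ℂ) * Complex.I_sq

theorem mukC_smul_left (k : ℂ) (x y : ℂ × (ℂ ⊗[ℝ] V) × ℂ) :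
    mukC B (k • x) y = k * mukC B x y := by
  simp only [mukC, Prod.smul_fst, Prod.smul_snd, map_smul, LinearMap.smul_apply, smul_eq_mul]
  ring

theorem mukC_smul_right (k : ℂ) (x y : ℂ × (ℂ ⊗[ℝ] V) × ℂ) :
    mukC B x (k • y) = k * mukC B x y := by
  simp only [mukC, Prod.smul_fst, Prod.smul_snd, map_smul, smul_eq_mul]
  ring

theorem MtoC_expv (β : V) : MtoC (expv B β) = expC B (toC β) := by
  simp [MtoC, expv, expC, baseChange_toC_toC]

theorem MtoC_rhoV : MtoC (rhoV V) = (0, 0, 1) := by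
  simp [MtoC, rhoV, toC]

theorem mukC_rho_right (x : ℂ × (ℂ ⊗[ℝ] V) × ℂ) : mukC B x (0, 0, 1) = -x.1 := by
  simp [mukC]

theorem mukC_iota_expC (β z : ℂ ⊗[ℝ] V) :
    mukC B (0, z, LinearMap.BilinForm.baseChange ℂ B z β) (expC B β) = 0 := by
  simp [mukC, expC]

theorem expC_add (hB : ∀ x y, B x y = B y x) (β z : ℂ ⊗[ℝ] V) :
    expC B (β + z) = expC B β + (0, z, LinearMap.BilinForm.baseChange ℂ B z β) +
      (LinearMap.BilinForm.baseChange ℂ B z z / 2) • ((0, 0, 1) : ℂ × (ℂ ⊗[ℝ] V) × ℂ) := by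
  refine Prod.ext (by simp [expC]) (Prod.ext (by simp [expC]) ?_)
  simp only [expC, map_add, LinearMap.add_apply, baseChange_comm B hB β z, Prod.snd_add,
    Prod.smul_snd, smul_eq_mul]
  ring

end MukaiComplexification

/-- Equations (2.18)–(2.20) (eq:Phi(exp), eq:stability-comm) and the following Remark:
the action of a Fourier–Mukai transform on the stability parameters. -/
theorem stmt17 {V V' : Type*}
    [AddCommGroup V] [Module ℝ V] [FiniteDimensional ℝ V]
    [AddCommGroup V'] [Module ℝ V'] [FiniteDimensional ℝ V']
    (B : V →ₗ[ℝ] V →ₗ[ℝ] ℝ) (B' : V' →ₗ[ℝ] V' →ₗ[ℝ] ℝ)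
    (hB : ∀ x y, B x y = B y x) (hB' : ∀ x y, B' x y = B' y x)
    (β η ω : V) (β' : V') (r₀ : ℝ) (hr₀ : 0 < r₀)
    (hηω : B η ω = 0)
    (c : ℝ) (hc : c = B η η - B ω ω) (hc0 : c ≠ 0)
    (Φ : (ℂ × (ℂ ⊗[ℝ] V) × ℂ) →ₗ[ℂ] (ℂ × (ℂ ⊗[ℝ] V') × ℂ))
    (hΦiso : ∀ x y, mukC B' (Φ x) (Φ y) = mukC B x y)
    (hΦe : Φ (MtoC (expv B β)) = (r₀⁻¹ : ℂ) • MtoC (rhoV V'))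
    (hΦρ : Φ (MtoC (rhoV V)) = (r₀ : ℂ) • MtoC (expv B' β')) :
    (∃! zh : ℂ ⊗[ℝ] V',
        Φ (0, toC η + Complex.I • toC ω,
            LinearMap.BilinForm.baseChange ℂ B (toC η + Complex.I • toC ω) (toC β))
          = -(0, zh, LinearMap.BilinForm.baseChange ℂ B' zh (toC β'))) ∧
    (∀ zh : ℂ ⊗[ℝ] V',
      Φ (0, toC η + Complex.I • toC ω,
          LinearMap.BilinForm.baseChange ℂ B (toC η + Complex.I • toC ω) (toC β))
        = -(0, zh, LinearMap.BilinForm.baseChange ℂ B' zh (toC β')) →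
      (Φ (expC B (toC (β + η) + Complex.I • toC ω)) =
          ((r₀ * c / 2 : ℝ) : ℂ) • expC B' (toC β' + (-(2 / (r₀ * c)) : ℂ) • zh)) ∧
      (∀ x : ℂ × (ℂ ⊗[ℝ] V) × ℂ,
          mukC B' (expC B' (toC β' + (-(2 / (r₀ * c)) : ℂ) • zh)) (Φ x) =
            ((2 / (r₀ * c) : ℝ) : ℂ) *
              mukC B (expC B (toC (β + η) + Complex.I • toC ω)) x) ∧
      (∃ ηt ωt : V',
          (-(2 / (r₀ * c)) : ℂ) • zh = toC ηt + Complex.I • toC ωt ∧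
          B' ηt ωt = 0 ∧
          (B' ωt ωt - B' ηt ηt) * (B ω ω - B η η) = 4 / r₀ ^ 2)) := by
  have hr : (r₀ : ℂ) ≠ 0 := by exact_mod_cast hr₀.ne'
  have hcC : (c : ℂ) ≠ 0 := by exact_mod_cast hc0
  rw [MtoC_expv, MtoC_rhoV] at hΦe
  rw [MtoC_expv, MtoC_rhoV] at hΦρ
  rw [toC_add, add_assoc]
  have hzz := baseChange_self_toC_add_I_smul_toC B hB η ω
  rw [hηω, ← hc] at hzz
  generalize toC η + Complex.I • toC ω = z at *
  generalize toC β = b at *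
  generalize toC β' = b' at *
  replace hzz : LinearMap.BilinForm.baseChange ℂ B z z = c := by simpa using hzz
  refine ⟨?_, fun zh hzh => ?_⟩
  · have h1 := hΦiso (0, z, LinearMap.BilinForm.baseChange ℂ B z b) (expC B b)
    have h2 := hΦiso (0, z, LinearMap.BilinForm.baseChange ℂ B z b) (0, 0, 1)
    rw [hΦe, mukC_smul_right, mukC_iota_expC, mukC_rho_right] at h1
    rw [hΦρ, mukC_smul_right, mukC_rho_right] at h2
    generalize Φ (0, z, LinearMap.BilinForm.baseChange ℂ B z b) = u at *
    obtain ⟨s, w, t⟩ := u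
    have hs : s = 0 := by simpa [hr] using h1
    have ht : t = LinearMap.BilinForm.baseChange ℂ B' w b' := by
      have := by simpa [hr, hs, mukC, expC] using h2
      linear_combination -this
    refine ⟨-w, by simp [hs, ht], fun y hy => ?_⟩
    have := congrArg (fun p => p.2.1) hy
    simpa using (congrArg Neg.neg this).symm
  · have hzz' : LinearMap.BilinForm.baseChange ℂ B' zh zh = c := by
      have h := hΦiso (0, z, LinearMap.BilinForm.baseChange ℂ B z b)
        (0, z, LinearMap.BilinForm.baseChange ℂ B z b)
      rw [hzh] at h
      simpa [mukC, hzz] using h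
    have hexp : Φ (expC B (b + z)) =
        ((r₀ * c / 2 : ℝ) : ℂ) • expC B' (b' + (-(2 / (r₀ * c)) : ℂ) • zh) := by
      rw [expC_add B hB, expC_add B' hB', map_add, map_add, map_smul, hΦe, hΦρ, hzh, hzz]
      simp only [map_smul, LinearMap.smul_apply, hzz', smul_eq_mul]
      refine Prod.ext ?_ (Prod.ext ?_ ?_)
      · simp [expC]
        ring
      · simp only [expC, Prod.snd_add, Prod.fst_add, Prod.smul_snd, Prod.smul_fst, Prod.snd_neg,
          Prod.fst_neg, smul_zero, zero_add, add_zero, smul_add, smul_smul]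
        push_cast
        match_scalars <;> field_simp
      · simp [expC]
        field_simp
        ring
    refine ⟨hexp, fun x => ?_, ?_⟩
    · rw [← hΦiso, hexp, mukC_smul_left, ← mul_assoc]
      push_cast
      field_simp
    · obtain ⟨ηt, ωt, h⟩ := exists_eq_toC_add_I_smul_toC ((-(2 / (r₀ * c)) : ℂ) • zh)
      have hq := baseChange_self_toC_add_I_smul_toC B' hB' ηt ωt
      have hk : (-(2 / (r₀ * c)) : ℂ) * ((-(2 / (r₀ * c)) : ℂ) * c) =
          ((4 / (r₀ ^ 2 * c) : ℝ) : ℂ) := by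
        push_cast
        field_simp
        norm_num
      rw [← h, map_smul, map_smul, LinearMap.smul_apply, hzz', smul_eq_mul, smul_eq_mul, hk] at hq
      have hre := congrArg Complex.re hq
      have him := congrArg Complex.im hq
      simp only [Complex.add_re, Complex.add_im, Complex.re_ofReal_mul, Complex.im_ofReal_mul,
        Complex.ofReal_re, Complex.ofReal_im, Complex.I_re, Complex.I_im] at hre him
      refine ⟨ηt, ωt, h, by linarith, ?_⟩
      have h1 : B' ωt ωt - B' ηt ηt = -(4 / (r₀ ^ 2 * c)) := by linarith
      have h2 : B ω ω - B η η = -c := by linarith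
      rw [h1, h2]
      field_simp
end
end
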